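/- There exist a constant c > 0 and a natural number k such that the following holds. Let F be a field of characteristic p (a prime or 0), let n ≥ 2, and let f : {0,1}^n → {0,1} be a symmetric Boolean function with standard decomposition (g,h). Then for every ε ∈ [2^{−n}, 1/3]: (i) if per(g) > 1 and per(g) is not a power of p, then pdeg^F_ε(f) ≥ c·√(n·log(1/ε)) / (log n)^k; (ii) if per(g) > 1, per(g) is a power of p, and B(h) = 0, then pdeg^F_ε(f) ≥ c·min{ √(n·log(1/ε)), per(g) } / (log n)^k; (iii) if per(g) is a power of p (possibly per(g) = 1) and B(h) ≥ 1, then pdeg^F_ε(f) ≥ c·min{ √(n·log(1/ε)), per(g) + √(B(h)·log(1/ε)) + log(1/ε) } / (log n)^k. -/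

import Mathlib

noncomputable section

open scoped BigOperators

/-- Embed a Boolean value into a field: `true ↦ 1`, `false ↦ 0`. -/
def bF (F : Type) [Field F] (b : Bool) : F := if b then 1 else 0

/-- A finitely supported probability distribution on polynomials in
`F[x_1,…,x_n]` (a probabilistic polynomial). -/
structure ProbPoly (F : Type) [Field F] (n : ℕ) where
  k : ℕ
  w : Fin k → ℝ
  w_nonneg : ∀ i, 0 ≤ w i
  w_sum : ∑ i, w i = 1
  poly : Fin k → MvPolynomial (Fin n) F

open Classical in
/-- The probability that the probabilistic polynomial `P` errs on input `a`
with respect to the Boolean function `f`. -/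
def errAt {F : Type} [Field F] {n : ℕ} (P : ProbPoly F n)
    (f : (Fin n → Bool) → Bool) (a : Fin n → Bool) : ℝ :=
  ∑ i, if MvPolynomial.eval (fun v => bF F (a v)) (P.poly i) = bF F (f a) then 0 else P.w i

/-- The ε-error probabilistic degree of a Boolean function over `F`: the least `d`
such that some probabilistic polynomial of degree at most `d` computes `f` with
error at most `ε` at each point. -/
def pdeg (F : Type) [Field F] {n : ℕ} (f : (Fin n → Bool) → Bool) (ε : ℝ) : ℕ :=
  sInf {d | ∃ P : ProbPoly F n, (∀ i, (P.poly i).totalDegree ≤ d) ∧ ∀ a, errAt P f a ≤ ε}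

/-- Hamming weight of a Boolean input. -/
def wt {n : ℕ} (a : Fin n → Bool) : ℕ := (Finset.univ.filter fun i => a i = true).card

/-- The period of a spectrum: the least `b ≥ 1` with `spec i = spec (i+b)`
whenever `i + b ≤ n`. -/
def period (n : ℕ) (spec : ℕ → Bool) : ℕ :=
  sInf {b | 1 ≤ b ∧ ∀ i, i + b ≤ n → spec i = spec (i + b)}

/-- `B(f)`: the least `k` such that the spectrum is constant on `[k, n-k]`. -/
def Bparam (n : ℕ) (spec : ℕ → Bool) : ℕ :=
  sInf {k | ∀ i j, k ≤ i → i + k ≤ n → k ≤ j → j + k ≤ n → spec i = spec j}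

section aux
open Polynomial

/-- monomial function -/
def chi (K : Type) [Field K] {N : ℕ} (T : Finset (Fin N)) : (Fin N → Bool) → K :=
  fun x => ∏ i ∈ T, bF K (x i)

/-- functions on the cube of degree at most `d` -/
def DegSub (K : Type) [Field K] (N d : ℕ) : Submodule K ((Fin N → Bool) → K) :=
  Submodule.span K {g | ∃ T : Finset (Fin N), T.card ≤ d ∧ g = chi K T}

section deg
variable {K : Type} [Field K] {N : ℕ}

lemma bF_mul_self (b : Bool) : bF K b * bF K b = bF K b := by
  cases b <;> simp [bF]

lemma chi_mul (S T : Finset (Fin N)) : chi K S * chi K T = chi K (S ∪ T) := by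
  classical
  funext x
  simp only [chi, Pi.mul_apply]
  rw [← Finset.prod_union_inter, ← Finset.prod_sdiff (Finset.inter_subset_union (s := S) (t := T)),
    mul_assoc, ← Finset.prod_mul_distrib]
  congr 1
  exact Finset.prod_congr rfl fun i _ => bF_mul_self _

lemma chi_mem {d : ℕ} {T : Finset (Fin N)} (h : T.card ≤ d) : chi K T ∈ DegSub K N d :=
  Submodule.subset_span ⟨T, h, rfl⟩

lemma deg_mono {a b : ℕ} (h : a ≤ b) : DegSub K N a ≤ DegSub K N b := by
  apply Submodule.span_mono
  rintro g ⟨T, hT, rfl⟩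
  exact ⟨T, hT.trans h, rfl⟩

lemma deg_mul {a b : ℕ} {f g : (Fin N → Bool) → K} (hf : f ∈ DegSub K N a)
    (hg : g ∈ DegSub K N b) : f * g ∈ DegSub K N (a + b) := by
  classical
  have h := Submodule.mul_mem_mul hf hg
  unfold DegSub at h
  rw [Submodule.span_mul_span] at h
  refine (Submodule.span_mono ?_) h
  rintro _ ⟨_, ⟨S, hS, rfl⟩, _, ⟨T, hT, rfl⟩, rfl⟩
  exact ⟨S ∪ T, (Finset.card_union_le _ _).trans (add_le_add hS hT), chi_mul S T⟩

lemma deg_one : (1 : (Fin N → Bool) → K) ∈ DegSub K N 0 := by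
  have : (1 : (Fin N → Bool) → K) = chi K ∅ := by funext x; simp [chi]
  rw [this]; exact chi_mem (by simp)

lemma deg_const (c : K) (d : ℕ) : (fun _ => c : (Fin N → Bool) → K) ∈ DegSub K N d := by
  have : (fun _ => c : (Fin N → Bool) → K) = c • 1 := by funext x; simp
  rw [this]; exact deg_mono (Nat.zero_le d) (Submodule.smul_mem _ _ deg_one)

lemma deg_coord (i : Fin N) : (fun x => bF K (x i) : (Fin N → Bool) → K) ∈ DegSub K N 1 := by
  have : (fun x => bF K (x i) : (Fin N → Bool) → K) = chi K {i} := by funext x; simp [chi]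
  rw [this]; exact chi_mem (by simp)

lemma deg_prod {ι : Type*} (S : Finset ι) (f : ι → (Fin N → Bool) → K) (e : ι → ℕ)
    (h : ∀ i ∈ S, f i ∈ DegSub K N (e i)) : ∏ i ∈ S, f i ∈ DegSub K N (∑ i ∈ S, e i) := by
  classical
  induction S using Finset.induction_on with
  | empty => simpa using deg_one
  | insert a S ha ih =>
    rw [Finset.prod_insert ha, Finset.sum_insert ha]
    exact deg_mul (h a (by simp)) (ih fun i hi => h i (by simp [hi]))

lemma deg_pow {f : (Fin N → Bool) → K} {d : ℕ} (hf : f ∈ DegSub K N d) (k : ℕ) :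
    f ^ k ∈ DegSub K N (k * d) := by
  have := deg_prod (Finset.range k) (fun _ => f) (fun _ => d) (fun _ _ => hf)
  simpa using this

lemma deg_affine (i : Fin N) (u v : K) :
    (fun x => if x i = true then u else v : (Fin N → Bool) → K) ∈ DegSub K N 1 := by
  have : (fun x => if x i = true then u else v : (Fin N → Bool) → K)
      = (u - v) • (fun x => bF K (x i)) + fun _ => v := by
    funext x; by_cases h : x i = true <;> simp [bF, h]
  rw [this]
  exact Submodule.add_mem _ (Submodule.smul_mem _ _ (deg_coord i)) (deg_const _ _)

lemma deg_comp {M d : ℕ} (σ : (Fin M → Bool) → (Fin N → Bool))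
    (hσ : ∀ i, (fun x => bF K (σ x i)) ∈ DegSub K M 1)
    {g : (Fin N → Bool) → K} (hg : g ∈ DegSub K N d) :
    (fun x => g (σ x)) ∈ DegSub K M d := by
  unfold DegSub at hg
  induction hg using Submodule.span_induction with
  | mem g hg =>
    obtain ⟨T, hT, rfl⟩ := hg
    have := deg_prod T (fun i => (fun x => bF K (σ x i))) (fun _ => 1) (fun i _ => hσ i)
    have e : (fun x => chi K T (σ x)) = ∏ i ∈ T, (fun x => bF K (σ x i)) := by
      funext x; simp [chi]
    rw [e]; exact deg_mono (by simpa using hT) this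
  | zero => exact Submodule.zero_mem _
  | add f g _ _ hf hg => exact Submodule.add_mem _ hf hg
  | smul c f _ hf => exact Submodule.smul_mem _ c hf

lemma deg_poly {F : Type} [Field F] (φ : F →+* K) (P : MvPolynomial (Fin N) F) {d : ℕ}
    (hd : P.totalDegree ≤ d) :
    (fun a => φ (MvPolynomial.eval (fun v => bF F (a v)) P)) ∈ DegSub K N d := by
  have e : (fun a => φ (MvPolynomial.eval (fun v => bF F (a v)) P)) =
      ∑ m ∈ P.support, φ (P.coeff m) • ∏ i ∈ m.support, (fun a : Fin N → Bool => bF K (a i)) ^ (m i) := by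
    funext a
    rw [MvPolynomial.eval_eq, map_sum]
    simp only [Finset.sum_apply, Pi.smul_apply, Finset.prod_apply, Pi.pow_apply, smul_eq_mul,
      map_mul, map_prod, map_pow]
    refine Finset.sum_congr rfl fun m _ => ?_
    congr 1
    refine Finset.prod_congr rfl fun i _ => ?_
    congr 1
    by_cases h : a i = true <;> simp [bF, h]
  rw [e]
  refine Submodule.sum_mem _ fun m hm => Submodule.smul_mem _ _ ?_
  refine deg_mono ?_ (deg_prod m.support _ (fun i => m i * 1) fun i _ => deg_pow (deg_coord i) _)
  simp only [mul_one]
  exact (MvPolynomial.le_totalDegree hm).trans hd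

end deg

open Classical in
/-- a random function of degree `d` computes the symmetric function `s(|x|)` with error `δ` -/
def Comp (K : Type) [Field K] (N d : ℕ) (δ : ℝ) (s : ℕ → K) : Prop :=
  ∃ (ι : Type) (_ : Fintype ι) (w : ι → ℝ) (G : ι → (Fin N → Bool) → K),
    (∀ i, 0 ≤ w i) ∧ ∑ i, w i = 1 ∧ (∀ i, G i ∈ DegSub K N d) ∧
    ∀ x, ∑ i, (if G i x = s (wt x) then 0 else w i) ≤ δ

/-- shift operator -/
def shiftE (K : Type) [Field K] : Module.End K (ℕ → K) where
  toFun s := fun i => s (i + 1)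
  map_add' _ _ := rfl
  map_smul' _ _ := rfl

/-- polynomial in the shift operator applied to a sequence -/
def op {K : Type} [Field K] (A : K[X]) (s : ℕ → K) : ℕ → K := aeval (shiftE K) A s

section op
variable {K : Type} [Field K]

lemma shiftE_pow (k : ℕ) (s : ℕ → K) (i : ℕ) : ((shiftE K) ^ k) s i = s (i + k) := by
  induction k generalizing s i with
  | zero => simp
  | succ k ih =>
    rw [pow_succ', Module.End.mul_apply]
    show ((shiftE K) ^ k) s (i + 1) = _
    rw [ih]; congr 1; ring

lemma op_eq {A : K[X]} {D : ℕ} (h : A.natDegree ≤ D) (s : ℕ → K) (i : ℕ) :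
    op A s i = ∑ k ∈ Finset.range (D + 1), A.coeff k * s (i + k) := by
  unfold op
  rw [aeval_eq_sum_range' (Nat.lt_succ_of_le h)]
  simp [shiftE_pow]

lemma op_mul (A B : K[X]) (s : ℕ → K) : op (A * B) s = op A (op B s) := by
  simp [op]

lemma op_zero_on {A : K[X]} {s : ℕ → K} {i D : ℕ} (hA : A.natDegree ≤ D)
    (h : ∀ k, k ≤ D → s (i + k) = 0) : op A s i = 0 := by
  rw [op_eq hA]
  refine Finset.sum_eq_zero fun k hk => ?_
  rw [h k (by simpa [Nat.lt_succ_iff] using hk), mul_zero]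

lemma op_X_pow (k : ℕ) (s : ℕ → K) (i : ℕ) : op (X ^ k) s i = s (i + k) := by
  simp [op, shiftE_pow]

lemma op_C_mul (c : K) (A : K[X]) (s : ℕ → K) (i : ℕ) : op (C c * A) s i = c * op A s i := by
  simp [op]

lemma op_sum {ι : Type*} (S : Finset ι) (A : ι → K[X]) (s : ℕ → K) (i : ℕ) :
    op (∑ k ∈ S, A k) s i = ∑ k ∈ S, op (A k) s i := by
  simp [op]

lemma op_sub (A B : K[X]) (s : ℕ → K) (i : ℕ) : op (A - B) s i = op A s i - op B s i := by
  simp [op]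

lemma op_X_sub_C_mul (ω : K) (B : K[X]) (s : ℕ → K) (i : ℕ) :
    op ((X - C ω) * B) s i = op B s (i + 1) - ω * op B s i := by
  rw [sub_mul, op_sub, op_C_mul]
  congr 1
  rw [op_mul]
  simpa using op_X_pow 1 (op B s) i

end op

/-- union bound -/
lemma comp_shift {K : Type} [Field K] {n M d : ℕ} {δ : ℝ} {s : ℕ → K} (hM : M ≤ n)
    (h : Comp K n d δ s) (c : K[X]) (hc : c.natDegree ≤ n - M) :
    Comp K M d ((n + 1) * δ) (op c s) := by
  classical
  obtain ⟨ι, _, w, G, hw, hw1, hG, herr⟩ := h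
  let σ : ℕ → (Fin M → Bool) → (Fin n → Bool) := fun k x v =>
    if hv : v.1 < M then x ⟨v.1, hv⟩ else decide (v.1 < M + k)
  have hwt : ∀ k, k ≤ n - M → ∀ x, wt (σ k x) = wt x + k := by
    intro k hk x
    obtain ⟨r, rfl⟩ := Nat.exists_eq_add_of_le hM
    have hk' : k ≤ r := by omega
    unfold wt
    rw [Finset.card_filter, Finset.card_filter, Fin.sum_univ_add]
    congr 1
    · refine Finset.sum_congr rfl fun i _ => ?_
      simp [σ]
    · have : ∀ i : Fin r, (if σ k x (Fin.natAdd M i) = true then 1 else 0) = if i.1 < k then 1 else 0 := by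
        intro i; simp [σ]
      rw [Finset.sum_congr rfl fun i _ => this i]
      rw [Fin.sum_univ_eq_sum_range (fun i => if i < k then 1 else 0) r]
      rw [← Finset.card_filter]
      have : Finset.filter (fun i => i < k) (Finset.range r) = Finset.range k := by
        ext i; simp; omega
      rw [this]; simp
  refine ⟨ι, inferInstance, w, fun i x => ∑ k ∈ Finset.range (n - M + 1), c.coeff k * G i (σ k x),
    hw, hw1, ?_, ?_⟩
  · intro i
    have e : (fun x => ∑ k ∈ Finset.range (n - M + 1), c.coeff k * G i (σ k x)) =
      ∑ k ∈ Finset.range (n - M + 1), c.coeff k • (fun x => G i (σ k x)) := by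
      funext x; simp
    beta_reduce
    rw [e]
    refine Submodule.sum_mem _ fun k _ => Submodule.smul_mem _ _ (deg_comp (σ k) ?_ (hG i))
    intro v
    by_cases hv : v.1 < M
    · simpa [σ, hv] using deg_coord (K := K) (⟨v.1, hv⟩ : Fin M)
    · simpa [σ, hv] using deg_const (K := K) (N := M) (bF K (decide (v.1 < M + k))) 1
  · intro x
    have hδ : 0 ≤ δ := le_trans (Finset.sum_nonneg fun i _ => by split_ifs <;> simp [hw]) (herr (fun _ => true))
    calc _ ≤ ∑ i, ∑ k ∈ Finset.range (n - M + 1), (if G i (σ k x) = s (wt (σ k x)) then 0 else w i) := by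
          refine Finset.sum_le_sum fun i _ => ?_
          split_ifs with hh
          · exact Finset.sum_nonneg fun k _ => by split_ifs <;> simp [hw]
          · have : ∃ k ∈ Finset.range (n - M + 1), G i (σ k x) ≠ s (wt (σ k x)) := by
              by_contra hcon
              push Not at hcon
              apply hh
              rw [op_eq hc]
              refine Finset.sum_congr rfl fun k hk => ?_
              rw [hcon k hk, hwt k (by simpa [Nat.lt_succ_iff] using hk)]
            obtain ⟨k, hk, hne⟩ := this
            refine le_trans ?_ (Finset.single_le_sum (f := fun k => if G i (σ k x) = s (wt (σ k x)) then 0 else w i) (fun k _ => by split_ifs <;> simp [hw]) hk)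
            simp [hne]
      _ = ∑ k ∈ Finset.range (n - M + 1), ∑ i, (if G i (σ k x) = s (wt (σ k x)) then 0 else w i) := Finset.sum_comm
      _ ≤ ∑ k ∈ Finset.range (n - M + 1), δ := Finset.sum_le_sum fun k _ => herr _
      _ = ((n - M : ℕ) + 1 : ℝ) * δ := by simp
      _ ≤ (n + 1) * δ := by
          gcongr
          omega


lemma sum_prod_cube {R : Type*} [CommSemiring R] {N : ℕ} (F : Fin N → Bool → R) :
    ∑ x : Fin N → Bool, ∏ i, F i (x i) = ∏ i, (F i true + F i false) := by
  classical
  have := (Finset.prod_univ_sum (fun _ : Fin N => (Finset.univ : Finset Bool)) F).symm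
  rw [Fintype.piFinset_univ] at this
  rw [this]
  simp

lemma pow_wt {R : Type*} [CommMonoid R] {N : ℕ} (a : R) (x : Fin N → Bool) :
    a ^ wt x = ∏ i, (if x i = true then a else 1) := by
  rw [Finset.prod_ite]; simp [wt]

/-- degree `< N` functions have vanishing top coefficient -/
lemma deg_alt_sum {K : Type} [Field K] {N d : ℕ} (hd : d < N) {g : (Fin N → Bool) → K}
    (hg : g ∈ DegSub K N d) : ∑ x, (-1) ^ wt x * g x = 0 := by
  classical
  unfold DegSub at hg
  induction hg using Submodule.span_induction with
  | mem g hg =>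
    obtain ⟨T, hT, rfl⟩ := hg
    have : ∃ i, i ∉ T := by
      by_contra hcon
      push Not at hcon
      have : T = Finset.univ := Finset.eq_univ_iff_forall.2 hcon
      rw [this] at hT; simp at hT; omega
    obtain ⟨i, hi⟩ := this
    have e : ∀ x : Fin N → Bool, (-1) ^ wt x * chi K T x =
        ∏ j, (fun (j : Fin N) (b : Bool) => (if b = true then (-1 : K) else 1) * (if j ∈ T then bF K b else 1)) j (x j) := by
      intro x
      rw [pow_wt, Finset.prod_mul_distrib, chi]
      congr 1
      rw [Finset.prod_ite_mem]; simp
    rw [Finset.sum_congr rfl fun x _ => e x,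
      sum_prod_cube (fun (j : Fin N) (b : Bool) =>
        (if b = true then (-1 : K) else 1) * (if j ∈ T then bF K b else 1))]
    apply Finset.prod_eq_zero (Finset.mem_univ i)
    simp [hi]
  | zero => simp
  | add f g _ _ hf hg => simp only [Pi.add_apply, mul_add, Finset.sum_add_distrib, hf, hg, add_zero]
  | smul c f _ hf =>
    simp only [Pi.smul_apply, smul_eq_mul]
    have : ∀ x : Fin N → Bool, (-1) ^ wt x * (c * f x) = c * ((-1) ^ wt x * f x) := fun x => by ring
    rw [Finset.sum_congr rfl fun x _ => this x, ← Finset.mul_sum, hf, mul_zero]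

/-- averaging: some outcome has few errors -/
lemma comp_avg {K : Type} [Field K] {N d : ℕ} {δ : ℝ} {s : ℕ → K} (h : Comp K N d δ s) :
    ∃ Q ∈ DegSub K N d, ∃ A : Finset (Fin N → Bool),
      (∀ x, x ∉ A → Q x = s (wt x)) ∧ (A.card : ℝ) ≤ δ * 2 ^ N := by
  classical
  obtain ⟨ι, _, w, G, hw, hw1, hG, herr⟩ := h
  let A : ι → Finset (Fin N → Bool) := fun i => Finset.univ.filter fun x => ¬ G i x = s (wt x)
  have key : ∑ i, w i * ((A i).card : ℝ) ≤ δ * 2 ^ N := by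
    calc ∑ i, w i * ((A i).card : ℝ) = ∑ i, ∑ x, (if G i x = s (wt x) then 0 else w i) := by
          refine Finset.sum_congr rfl fun i _ => ?_
          simp only [A]
          rw [Finset.card_filter]
          push_cast
          rw [Finset.mul_sum]
          refine Finset.sum_congr rfl fun x _ => ?_
          by_cases hh : G i x = s (wt x) <;> simp [hh]
      _ = ∑ x, ∑ i, (if G i x = s (wt x) then 0 else w i) := Finset.sum_comm
      _ ≤ ∑ x : Fin N → Bool, δ := Finset.sum_le_sum fun x _ => herr x
      _ = δ * 2 ^ N := by simp [mul_comm]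
  have : ∃ i, ((A i).card : ℝ) ≤ δ * 2 ^ N := by
    by_contra hcon
    push Not at hcon
    have h1 : ∑ i, w i * (δ * 2 ^ N) < ∑ i, w i * ((A i).card : ℝ) := by
      have hex : ∃ i, 0 < w i := by
        by_contra hc
        push Not at hc
        have : ∑ i, w i ≤ 0 := Finset.sum_nonpos fun i _ => hc i
        linarith
      obtain ⟨i, hi⟩ := hex
      refine Finset.sum_lt_sum (fun i _ => mul_le_mul_of_nonneg_left (hcon i).le (hw i)) ⟨i, Finset.mem_univ _, ?_⟩
      exact mul_lt_mul_of_pos_left (hcon i) hi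
    rw [← Finset.sum_mul, hw1] at h1
    linarith
  obtain ⟨i, hi⟩ := this
  exact ⟨G i, hG i, A i, fun x hx => by simpa [A] using hx, hi⟩

/-- union bound over the whole cube -/
lemma comp_all {K : Type} [Field K] {N d : ℕ} {δ : ℝ} {s : ℕ → K} (h : Comp K N d δ s)
    (hd : d < N) (hs : ∑ x : Fin N → Bool, (-1) ^ wt x * s (wt x) ≠ 0) : 1 ≤ δ * 2 ^ N := by
  by_contra hcon
  push Not at hcon
  obtain ⟨Q, hQ, A, hA, hc⟩ := comp_avg h
  have : A.card = 0 := by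
    have : (A.card : ℝ) < 1 := lt_of_le_of_lt hc hcon
    exact_mod_cast Nat.lt_one_iff.1 (by exact_mod_cast this)
  rw [Finset.card_eq_zero] at this
  subst this
  apply hs
  rw [← deg_alt_sum hd hQ]
  refine Finset.sum_congr rfl fun x _ => ?_
  rw [hA x (by simp)]

/-- Smolensky's dimension argument -/
lemma smolensky {K : Type} [Field K] {M d : ℕ} {ω : K} (h0 : ω ≠ 0) (h1 : ω ≠ 1)
    {Q : (Fin M → Bool) → K} (hQ : Q ∈ DegSub K M d) (A : Finset (Fin M → Bool))
    (hA : ∀ x ∈ A, Q x = ω ^ wt x) :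
    A.card ≤ (Finset.univ.filter fun T : Finset (Fin M) => T.card ≤ M / 2 + d).card := by
  classical
  set D := M / 2 + d with hD
  let res : ((Fin M → Bool) → K) →ₗ[K] (A → K) :=
    { toFun := fun g x => g x.1, map_add' := fun _ _ => rfl, map_smul' := fun _ _ => rfl }
  let U : Submodule K ((Fin M → Bool) → K) := (Submodule.map res (DegSub K M D)).comap res
  have hU : ∀ g, g ∈ U ↔ ∃ g' ∈ DegSub K M D, ∀ x ∈ A, g' x = g x := by
    intro g
    simp only [U, Submodule.mem_comap, Submodule.mem_map]
    refine exists_congr fun g' => and_congr_right fun _ => ?_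
    rw [funext_iff]
    simp [res]
  let y : Fin M → (Fin M → Bool) → K := fun i x => if x i = true then ω else 1
  let y' : Fin M → (Fin M → Bool) → K := fun i x => if x i = true then ω⁻¹ else 1
  have hY : ∀ S : Finset (Fin M), (∏ i ∈ S, y i) ∈ U := by
    intro S
    rw [hU]
    by_cases hS : S.card ≤ M / 2
    · refine ⟨_, ?_, fun x _ => rfl⟩
      refine deg_mono ?_ (deg_prod S y (fun _ => 1) fun i _ => deg_affine i _ _)
      simp; omega
    · refine ⟨Q * ∏ i ∈ Sᶜ, y' i, ?_, ?_⟩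
      · refine deg_mono ?_ (deg_mul hQ (deg_prod Sᶜ y' (fun _ => 1) fun i _ => deg_affine i _ _))
        simp [Finset.card_compl]; omega
      · intro x hx
        simp only [Pi.mul_apply, Finset.prod_apply]
        rw [hA x hx, pow_wt, ← Finset.prod_mul_prod_compl S, mul_assoc, ← Finset.prod_mul_distrib]
        have : ∏ i ∈ Sᶜ, ((if x i = true then ω else 1) * y' i x) = 1 := by
          refine Finset.prod_eq_one fun i _ => ?_
          by_cases hx : x i = true <;> simp [y', hx, h0]
        rw [this, mul_one]
  have hω : ω - 1 ≠ 0 := sub_ne_zero.2 h1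
  have hpt : ∀ a : Fin M → Bool, (fun x => if x = a then (1 : K) else 0) ∈ U := by
    intro a
    let α : Fin M → K := fun i => if a i = true then 1 / (ω - 1) else -1 / (ω - 1)
    let β : Fin M → K := fun i => if a i = true then -1 / (ω - 1) else ω / (ω - 1)
    have e : (fun x => if x = a then (1 : K) else 0) =
        ∑ S ∈ (Finset.univ : Finset (Fin M)).powerset,
          ((∏ i ∈ S, α i) * ∏ i ∈ Finset.univ \ S, β i) • ∏ i ∈ S, y i := by
      funext x
      simp only [Finset.sum_apply, Pi.smul_apply, Finset.prod_apply, smul_eq_mul]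
      have : ∀ S : Finset (Fin M), ((∏ i ∈ S, α i) * ∏ i ∈ Finset.univ \ S, β i) * ∏ i ∈ S, y i x
          = (∏ i ∈ S, (α i * y i x)) * ∏ i ∈ Finset.univ \ S, β i := by
        intro S; rw [Finset.prod_mul_distrib]; ring
      rw [Finset.sum_congr rfl fun S _ => this S, ← Finset.prod_add]
      have hi : ∀ i, α i * y i x + β i = if x i = a i then 1 else 0 := by
        intro i
        cases hx : x i <;> cases ha : a i <;> simp [α, β, y, hx, ha] <;> field_simp <;> ring
      rw [Finset.prod_congr rfl fun i _ => hi i]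
      by_cases hxa : x = a
      · simp [hxa]
      · rw [if_neg hxa]
        have : ∃ i, x i ≠ a i := by
          by_contra hc; push Not at hc; exact hxa (funext hc)
        obtain ⟨i, hi⟩ := this
        exact (Finset.prod_eq_zero (Finset.mem_univ i) (by simp [hi])).symm
    rw [e]
    exact Submodule.sum_mem _ fun S _ => Submodule.smul_mem _ _ (hY S)
  have htop : Submodule.map res (DegSub K M D) = ⊤ := by
    rw [eq_top_iff]
    intro g _
    have : g = ∑ a : A, g a • res (fun x => if x = a.1 then (1 : K) else 0) := by
      funext x
      simp [res, Finset.sum_apply]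
    rw [this]
    exact Submodule.sum_mem _ fun a _ => Submodule.smul_mem _ _ (hpt a.1)
  have hfr : Module.finrank K (A → K) = A.card := by simp
  let S := (Finset.univ.filter fun T : Finset (Fin M) => T.card ≤ D)
  have hspan : DegSub K M D = Submodule.span K ((S.image (chi K) : Finset ((Fin M → Bool) → K)) : Set ((Fin M → Bool) → K)) := by
    unfold DegSub
    congr 1
    ext g
    simp only [Set.mem_ofPred_eq, Finset.coe_image, Set.mem_image, Finset.mem_coe, S, Finset.mem_filter, Finset.mem_univ, true_and]
    exact exists_congr fun T => and_congr_right fun _ => eq_comm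
  calc A.card = Module.finrank K (⊤ : Submodule K (A → K)) := by rw [finrank_top, hfr]
    _ = Module.finrank K (Submodule.map res (DegSub K M D)) := by rw [htop]
    _ ≤ Module.finrank K (DegSub K M D) := Submodule.finrank_map_le _ _
    _ ≤ (S.image (chi K)).card := by
        rw [hspan]; exact finrank_span_finset_le_card _
    _ ≤ S.card := Finset.card_image_le

lemma smolensky_choose {K : Type} [Field K] {M d : ℕ} {ω : K} (h0 : ω ≠ 0) (h1 : ω ≠ 1)
    {Q : (Fin M → Bool) → K} (hQ : Q ∈ DegSub K M d) (A : Finset (Fin M → Bool))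
    (hA : ∀ x, x ∉ A → Q x = ω ^ wt x) :
    M.choose (M / 2 + d + 1) ≤ A.card := by
  classical
  have h := smolensky h0 h1 hQ Aᶜ (fun x hx => hA x (by simpa using hx))
  have h2 : (Finset.univ.filter fun T : Finset (Fin M) => T.card ≤ M / 2 + d).card
      + (Finset.univ.filter fun T : Finset (Fin M) => ¬ T.card ≤ M / 2 + d).card = 2 ^ M := by
    rw [Finset.card_filter_add_card_filter_not]; simp
  have h3 : M.choose (M / 2 + d + 1) ≤ (Finset.univ.filter fun T : Finset (Fin M) => ¬ T.card ≤ M / 2 + d).card := by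
    have : (Finset.powersetCard (M / 2 + d + 1) (Finset.univ : Finset (Fin M))).card = M.choose (M / 2 + d + 1) := by simp
    rw [← this]
    apply Finset.card_le_card
    intro T hT
    simp [Finset.mem_powersetCard] at hT ⊢
    omega
  have h4 : Aᶜ.card + A.card = 2 ^ M := by
    rw [Finset.card_compl_add_card]; simp
  omega


lemma amplify {K : Type} [Field K] {N d : ℕ} {ε : ℝ} {s : ℕ → K}
    (hs : ∀ i, s i = 0 ∨ s i = 1) (h : Comp K N d ε s) (r : ℕ) (μ : ℝ) (hμ : 1 ≤ μ) :
    Comp K N ((2 * r + 1) * d) ((1 + ε * (μ - 1)) ^ (2 * r + 1) / μ ^ (r + 1)) s := by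
  classical
  obtain ⟨ι, _, w, G, hw, hw1, hG, herr⟩ := h
  set t := 2 * r + 1 with ht
  let P : (Fin t → ι) → Finset (Fin t) → (Fin N → Bool) → K := fun τ S =>
    (∏ j ∈ S, G (τ j)) * ∏ j ∈ Finset.univ \ S, (1 - G (τ j))
  let H : (Fin t → ι) → (Fin N → Bool) → K := fun τ =>
    ∑ S ∈ (Finset.univ : Finset (Fin t)).powerset.filter (fun S => r + 1 ≤ S.card), P τ S
  have hone : ∀ τ x, ∑ S ∈ (Finset.univ : Finset (Fin t)).powerset, P τ S x = 1 := by
    intro τ x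
    simp only [P, Pi.mul_apply, Finset.prod_apply]
    rw [← Finset.prod_add]
    simp
  have hcorrect : ∀ τ x, (Finset.univ.filter fun j => ¬ G (τ j) x = s (wt x)).card ≤ r →
      H τ x = s (wt x) := by
    intro τ x hc
    have hex : ∀ S : Finset (Fin t), r + 1 ≤ S.card → ∃ j ∈ S, G (τ j) x = s (wt x) := by
      intro S hS
      by_contra hcon
      push Not at hcon
      have : S ⊆ (Finset.univ.filter fun j => ¬ G (τ j) x = s (wt x)) := by
        intro j hj; simpa using hcon j hj
      have := Finset.card_le_card this
      omega
    rcases hs (wt x) with h0 | h1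
    · simp only [H, Finset.sum_apply]
      rw [h0]
      refine Finset.sum_eq_zero fun S hS => ?_
      obtain ⟨j, hj, hjx⟩ := hex S (Finset.mem_filter.1 hS).2
      simp only [P, Pi.mul_apply, Finset.prod_apply]
      rw [Finset.prod_eq_zero hj (by rw [hjx, h0]), zero_mul]
    · rw [h1, ← hone τ x]
      simp only [H, Finset.sum_apply]
      refine Finset.sum_subset (Finset.filter_subset _ _) fun S hS hS' => ?_
      have hcard : r + 1 ≤ (Finset.univ \ S).card := by
        rw [Finset.card_univ_sdiff]
        simp at hS' ⊢
        omega
      obtain ⟨j, hj, hjx⟩ := hex _ hcard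
      simp only [P, Pi.mul_apply, Finset.prod_apply]
      rw [Finset.prod_eq_zero hj (by simp [hjx, h1]), mul_zero]
  refine ⟨Fin t → ι, inferInstance, fun τ => ∏ j, w (τ j), H, fun τ => Finset.prod_nonneg fun j _ => hw _, ?_, ?_, ?_⟩
  · rw [← Fintype.piFinset_univ, ← Finset.prod_univ_sum]
    simp [hw1]
  · intro τ
    refine Submodule.sum_mem _ fun S _ => ?_
    have h1 := deg_prod S (fun j => G (τ j)) (fun _ => d) fun j _ => hG _
    have h2 := deg_prod (Finset.univ \ S) (fun j => 1 - G (τ j)) (fun _ => d) fun j _ =>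
      Submodule.sub_mem _ (deg_mono (Nat.zero_le d) deg_one) (hG _)
    refine deg_mono (le_of_eq ?_) (deg_mul h1 h2)
    rw [Finset.sum_const, Finset.sum_const, smul_eq_mul, smul_eq_mul, ← add_mul]
    congr 1
    have := Finset.card_sdiff_add_card_eq_card (Finset.subset_univ S)
    simp at this
    rw [add_comm]; simpa using this
  · intro x
    have hμ0 : 0 < μ := by linarith
    have hpt : ∀ τ, (if H τ x = s (wt x) then 0 else ∏ j, w (τ j)) ≤
        (∏ j, w (τ j) * (if G (τ j) x = s (wt x) then 1 else μ)) / μ ^ (r + 1) := by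
      intro τ
      have hnn : 0 ≤ ∏ j, w (τ j) := Finset.prod_nonneg fun j _ => hw _
      split_ifs with hh
      · apply div_nonneg _ (by positivity)
        refine Finset.prod_nonneg fun j _ => mul_nonneg (hw _) (by split_ifs <;> linarith)
      · have hc : r + 1 ≤ (Finset.univ.filter fun j => ¬ G (τ j) x = s (wt x)).card := by
          by_contra hcon
          exact hh (hcorrect τ x (by omega))
        rw [le_div_iff₀ (by positivity), Finset.prod_mul_distrib]
        apply mul_le_mul_of_nonneg_left _ hnn
        rw [Finset.prod_ite]
        simp only [Finset.prod_const_one, one_mul, Finset.prod_const]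
        exact pow_le_pow_right₀ hμ hc
    refine (Finset.sum_le_sum fun τ _ => hpt τ).trans ?_
    rw [← Finset.sum_div]
    apply div_le_div_of_nonneg_right _ (by positivity)
    have e : ∑ τ : Fin t → ι, ∏ j, w (τ j) * (if G (τ j) x = s (wt x) then 1 else μ)
        = (∑ i, w i * (if G i x = s (wt x) then 1 else μ)) ^ t := by
      have := Finset.prod_univ_sum (fun _ : Fin t => (Finset.univ : Finset ι))
        (fun _ i => w i * (if G i x = s (wt x) then 1 else μ))
      rw [Fintype.piFinset_univ] at this
      rw [← this]; simp
    rw [e]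
    apply pow_le_pow_left₀
    · exact Finset.sum_nonneg fun j _ => mul_nonneg (hw _) (by split_ifs <;> linarith)
    · have : ∀ i, w i * (if G i x = s (wt x) then 1 else μ) = w i + (if G i x = s (wt x) then 0 else w i) * (μ - 1) := by
        intro i; split_ifs <;> ring
      rw [Finset.sum_congr rfl fun i _ => this i, Finset.sum_add_distrib, hw1, ← Finset.sum_mul]
      have := herr x
      have h2 : 0 ≤ μ - 1 := by linarith
      gcongr
      

lemma comp_mono {K : Type} [Field K] {N d d' : ℕ} {δ δ' : ℝ} {s : ℕ → K}
    (h : Comp K N d δ s) (hd : d ≤ d') (hδ : δ ≤ δ') : Comp K N d' δ' s := by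
  obtain ⟨ι, i1, w, G, hw, hw1, hG, herr⟩ := h
  exact ⟨ι, i1, w, G, hw, hw1, fun i => deg_mono hd (hG i), fun x => (herr x).trans hδ⟩

lemma amplify' {K : Type} [Field K] {N d : ℕ} {ε : ℝ} {s : ℕ → K}
    (hs : ∀ i, s i = 0 ∨ s i = 1) (h : Comp K N d ε s) (h0 : 0 < ε) (h3 : ε ≤ 1 / 3)
    (u : ℕ) (hu : 1 ≤ u) : Comp K N (64 * u * d) (ε ^ u) s := by
  obtain ⟨r, hr⟩ : ∃ r, 32 * u = r + 1 := ⟨32 * u - 1, by omega⟩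
  have hd : (2 * r + 1) * d ≤ 64 * u * d := Nat.mul_le_mul_right _ (by omega)
  by_cases h16 : ε ≤ 1 / 16
  · refine comp_mono (amplify hs h r (1 / ε) ?_) hd ?_
    · rw [le_div_iff₀ h0]; linarith
    · have e : 1 + ε * (1 / ε - 1) = 2 - ε := by field_simp; ring
      rw [e, one_div, inv_pow, div_inv_eq_mul]
      calc (2 - ε) ^ (2 * r + 1) * ε ^ (r + 1) ≤ 2 ^ (2 * r + 1) * ε ^ (r + 1) := by
            gcongr <;> linarith
        _ ≤ 2 ^ (2 * (r + 1)) * ε ^ (r + 1) := by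
            gcongr <;> norm_num
        _ = (4 * ε) ^ (32 * u) := by rw [pow_mul, ← mul_pow, hr]; norm_num
        _ ≤ (4 * ε) ^ (2 * u) := by
            apply pow_le_pow_of_le_one <;> linarith
        _ = ((4 * ε) ^ 2) ^ u := by rw [pow_mul]
        _ ≤ ε ^ u := by
            gcongr
            nlinarith
  · push Not at h16
    refine comp_mono (amplify hs h r 2 (by norm_num)) hd ?_
    calc (1 + ε * (2 - 1)) ^ (2 * r + 1) / 2 ^ (r + 1) ≤ (4 / 3) ^ (2 * r + 1) / 2 ^ (r + 1) := by
          gcongr; linarith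
      _ ≤ (4 / 3) ^ (2 * (r + 1)) / 2 ^ (r + 1) := by
          gcongr
          · norm_num
          · omega
      _ = ((8 / 9) ^ 32) ^ u := by rw [pow_mul, ← div_pow, ← pow_mul, hr]; norm_num
      _ ≤ (1 / 16) ^ u := by gcongr; norm_num
      _ ≤ ε ^ u := by gcongr

lemma choose_lower {M k : ℕ} (hk : 8 * k ≤ M) (hM : 1 ≤ M) :
    (2 : ℝ) ^ M * Real.exp (-(8 * k ^ 2 / M)) ≤ (M + 1) * (M.choose (M / 2 + k) : ℝ) := by
  have hM0 : (0 : ℝ) < M := by exact_mod_cast hM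
  have hk' : 8 * (k : ℝ) ≤ M := by exact_mod_cast hk
  have h1 : ∀ t, t ≤ k → (M.choose (M / 2) : ℝ) * Real.exp (-(8 * k / M)) ^ t ≤ M.choose (M / 2 + t) := by
    intro t
    induction t with
    | zero => simp
    | succ t ih =>
      intro ht
      have ih := ih (by omega)
      have hrec := Nat.choose_succ_right_eq M (M / 2 + t)
      have hle : M / 2 + t ≤ M := by omega
      have hrec' : (M.choose (M / 2 + t + 1) : ℝ) * ((M / 2 + t : ℕ) + 1) =
          M.choose (M / 2 + t) * (M - (M / 2 + t : ℕ)) := by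
        rw [← Nat.cast_sub hle]; exact_mod_cast hrec
      set i : ℕ := M / 2 + t with hi
      have hi2 : (i : ℝ) ≤ M / 2 + t := by
        have : 2 * i ≤ M + 2 * t := by omega
        have : 2 * (i : ℝ) ≤ M + 2 * t := by exact_mod_cast this
        linarith
      have hi3 : (M : ℝ) ≤ 2 * (i + 1) := by
        have : M ≤ 2 * (i + 1) := by omega
        exact_mod_cast this
      have htk : (t : ℝ) + 1 ≤ k := by exact_mod_cast ht
      have ht0 : (0 : ℝ) ≤ t := by positivity
      set x : ℝ := 4 * k / M with hx
      have hx0 : 0 ≤ x := by positivity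
      have hxM : x * M = 4 * k := by rw [hx]; field_simp
      have hx2 : x ≤ 1 / 2 := by rw [hx, div_le_iff₀ hM0]; linarith
      have hexp : Real.exp (-(8 * k / M)) ≤ 1 - x := by
        have e : -(8 * k / M : ℝ) = -(2 * x) := by rw [hx]; ring
        rw [e, Real.exp_neg]
        have := Real.add_one_le_exp (2 * x)
        rw [inv_le_comm₀ (Real.exp_pos _) (by linarith)]
        refine le_trans ?_ this
        rw [inv_le_iff_one_le_mul₀ (by linarith)]
        nlinarith
      have hi0 : (0 : ℝ) < i + 1 := by positivity
      have hratio : (1 - x) * (i + 1) ≤ M - i := by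
        nlinarith [mul_le_mul_of_nonneg_left hi3 hx0]
      rw [← add_assoc, ← hi, pow_succ, ← mul_assoc]
      have hc : (M.choose (i + 1) : ℝ) = M.choose i * (M - i) / (i + 1) := by
        rw [eq_div_iff hi0.ne']; exact hrec'
      rw [hc, le_div_iff₀ hi0]
      have hch : (0 : ℝ) ≤ M.choose i := by positivity
      calc _ ≤ M.choose i * (1 - x) * (i + 1) := by
            gcongr
        _ = M.choose i * ((1 - x) * (i + 1)) := by ring
        _ ≤ _ := by gcongr
  have h2 := h1 k le_rfl
  have h3 : (2 : ℝ) ^ M ≤ (M + 1) * M.choose (M / 2) := by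
    have : 2 ^ M ≤ (M + 1) * M.choose (M / 2) := by
      rw [← Nat.sum_range_choose]
      refine (Finset.sum_le_sum fun i _ => Nat.choose_le_middle i M).trans ?_
      simp
    exact_mod_cast this
  have e : Real.exp (-(8 * k ^ 2 / M)) = Real.exp (-(8 * k / M)) ^ k := by
    rw [← Real.exp_nat_mul]; congr 1; ring
  rw [e]
  calc _ ≤ (M + 1) * M.choose (M / 2) * Real.exp (-(8 * k / M)) ^ k := by gcongr
    _ = (M + 1) * (M.choose (M / 2) * Real.exp (-(8 * k / M)) ^ k) := by ring
    _ ≤ _ := by gcongr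

open Classical in
lemma tail_upper {M : ℕ} (hM : 1 ≤ M) (h : ℝ) (hh : 0 ≤ h) :
    ((Finset.univ.filter fun x : Fin M → Bool => h < |(wt x : ℝ) - M / 2|).card : ℝ) ≤
      2 * 2 ^ M * Real.exp (-(2 * h ^ 2 / M)) := by
  have hM0 : (0 : ℝ) < M := by exact_mod_cast hM
  set lam : ℝ := 2 * h / M with hl
  have hl0 : 0 ≤ lam := by positivity
  have hlM : lam * M = 2 * h := by rw [hl]; field_simp
  have hsum : ∀ ν : ℝ, |ν| = lam → ∑ x : Fin M → Bool, Real.exp (ν * (2 * wt x - M)) ≤ 2 ^ M * Real.exp (M * lam ^ 2 / 2) := by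
    intro ν hν
    have e : ∀ x : Fin M → Bool, Real.exp (ν * (2 * wt x - M)) = ∏ i, (fun (_ : Fin M) (b : Bool) => if b = true then Real.exp ν else Real.exp (-ν)) i (x i) := by
      intro x
      have : ν * (2 * wt x - M) = ∑ i, (if x i = true then ν else -ν) := by
        have hw : (wt x : ℝ) = ∑ i, (if x i = true then 1 else 0) := by simp [wt]
        have hMM : (M : ℝ) = ∑ i : Fin M, 1 := by simp
        rw [hw, Finset.mul_sum]
        conv_lhs => rw [hMM]
        rw [← Finset.sum_sub_distrib, Finset.mul_sum]
        refine Finset.sum_congr rfl fun i _ => ?_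
        split_ifs <;> ring
      rw [this, Real.exp_sum]
      refine Finset.prod_congr rfl fun i _ => ?_
      dsimp only
      split_ifs <;> rfl
    rw [Finset.sum_congr rfl fun x _ => e x,
      sum_prod_cube (fun (_ : Fin M) (b : Bool) => if b = true then Real.exp ν else Real.exp (-ν))]
    simp only [if_true, Bool.false_eq_true, if_false, Finset.prod_const, Finset.card_univ, Fintype.card_fin]
    have hc : Real.exp ν + Real.exp (-ν) = 2 * Real.cosh ν := by rw [Real.cosh_eq]; ring
    rw [hc, mul_pow]
    gcongr
    calc Real.cosh ν ^ M ≤ Real.exp (ν ^ 2 / 2) ^ M := by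
          gcongr
          exact Real.cosh_le_exp_half_sq ν
      _ = Real.exp (M * lam ^ 2 / 2) := by
          rw [← Real.exp_nat_mul, ← hν, sq_abs]; congr 1; ring
  have hpt : ∀ x : Fin M → Bool, (if h < |(wt x : ℝ) - M / 2| then (1 : ℝ) else 0) ≤
      Real.exp (-(2 * lam * h)) * (Real.exp (lam * (2 * wt x - M)) + Real.exp ((-lam) * (2 * wt x - M))) := by
    intro x
    split_ifs with hx
    · rw [mul_add, ← Real.exp_add, ← Real.exp_add]
      rcases lt_abs.1 hx with h1 | h1
      · have : 1 ≤ Real.exp (-(2 * lam * h) + lam * (2 * wt x - M)) := by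
          apply Real.one_le_exp; nlinarith
        have := Real.exp_pos (-(2 * lam * h) + (-lam) * (2 * wt x - M))
        linarith
      · have : 1 ≤ Real.exp (-(2 * lam * h) + (-lam) * (2 * wt x - M)) := by
          apply Real.one_le_exp; nlinarith
        have := Real.exp_pos (-(2 * lam * h) + lam * (2 * wt x - M))
        linarith
    · positivity
  rw [Finset.card_filter]
  push_cast
  refine (Finset.sum_le_sum fun x _ => hpt x).trans ?_
  rw [← Finset.mul_sum, Finset.sum_add_distrib]
  have a1 := hsum lam (abs_of_nonneg hl0)
  have a2 := hsum (-lam) (by rw [abs_neg, abs_of_nonneg hl0])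
  have e2 : Real.exp (-(2 * h ^ 2 / M)) = Real.exp (-(2 * lam * h)) * Real.exp (M * lam ^ 2 / 2) := by
    rw [← Real.exp_add]; congr 1; rw [hl]; field_simp; ring
  rw [e2]
  calc _ ≤ Real.exp (-(2 * lam * h)) * (2 ^ M * Real.exp (M * lam ^ 2 / 2) + 2 ^ M * Real.exp (M * lam ^ 2 / 2)) := by gcongr
    _ = _ := by ring

open Classical in
/-- quantitative Smolensky bound -/
lemma smol_main {K : Type} [Field K] {M d : ℕ} {δ : ℝ} {L : ℝ} {ω : K} (h0 : ω ≠ 0) (h1 : ω ≠ 1)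
    {φ : ℕ → K} (h : Comp K M d δ φ) (hM : 1 ≤ M) (hL : 1 ≤ L) (hδ : δ ≤ Real.exp (-(16 * L)))
    (hML : (M : ℝ) + 1 ≤ Real.exp L)
    (hbad : ((Finset.univ.filter fun x : Fin M → Bool => φ (wt x) ≠ ω ^ wt x).card : ℝ)
      ≤ 2 * 2 ^ M * Real.exp (-(16 * L))) :
    M < 8 * (d + 1) ∨ L * M ≤ ((d : ℝ) + 1) ^ 2 := by
  by_contra hcon
  push Not at hcon
  obtain ⟨hc1, hc2⟩ := hcon
  have hM0 : (0 : ℝ) < M := by exact_mod_cast hM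
  obtain ⟨Q, hQ, A, hA, hAc⟩ := comp_avg h
  set Bd := (Finset.univ.filter fun x : Fin M → Bool => φ (wt x) ≠ ω ^ wt x)
  have hs := smolensky_choose h0 h1 hQ (A ∪ Bd) (by
    intro x hx
    simp only [Finset.mem_union, not_or, Bd, Finset.mem_filter, Finset.mem_univ, true_and, not_not] at hx
    rw [hA x hx.1]; exact hx.2)
  have hs2 : (M.choose (M / 2 + (d + 1)) : ℝ) ≤ 3 * 2 ^ M * Real.exp (-(16 * L)) := by
    have : (M.choose (M / 2 + (d + 1)) : ℝ) ≤ A.card + Bd.card := by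
      exact_mod_cast hs.trans (Finset.card_union_le _ _)
    have : (A.card : ℝ) ≤ Real.exp (-(16 * L)) * 2 ^ M := hAc.trans (by gcongr)
    linarith
  have hlow := choose_lower hc1 hM
  have e3 : (3 : ℝ) ≤ Real.exp (2 * L) := by
    have := Real.add_one_le_exp (2 * L); linarith
  have hfin : (2 : ℝ) ^ M * Real.exp (-(8 * ((d + 1 : ℕ) : ℝ) ^ 2 / M)) ≤ 2 ^ M * Real.exp (-(13 * L)) := by
    calc _ ≤ ((M : ℝ) + 1) * (3 * 2 ^ M * Real.exp (-(16 * L))) := hlow.trans (by gcongr)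
      _ ≤ Real.exp L * (Real.exp (2 * L) * 2 ^ M * Real.exp (-(16 * L))) := by gcongr
      _ = 2 ^ M * (Real.exp L * Real.exp (2 * L) * Real.exp (-(16 * L))) := by ring
      _ = _ := by rw [← Real.exp_add, ← Real.exp_add]; congr 2; ring
  have := le_of_mul_le_mul_left hfin (by positivity)
  rw [Real.exp_le_exp, neg_le_neg_iff, le_div_iff₀ hM0] at this
  push_cast at this
  nlinarith


section alg
variable {K : Type} [Field K]

lemma hankel {s : ℕ → K} {r N i1 : ℕ}
    (h : ∀ A : K[X], A.natDegree ≤ r → (∀ i, i1 ≤ i → i ≤ i1 + N → op A s i = 0) → A = 0)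
    (φ : ℕ → K) : ∃ c : K[X], c.natDegree ≤ N ∧ ∀ k, k ≤ r → op c s (i1 + k) = φ k := by
  classical
  let T : (Fin (N + 1) → K) →ₗ[K] (Fin (r + 1) → K) :=
    { toFun := fun c k => ∑ i : Fin (N + 1), c i * s (i1 + k + i)
      map_add' := by intro x y; funext k; simp [add_mul, Finset.sum_add_distrib]
      map_smul' := by intro x y; funext k; simp [mul_assoc, Finset.mul_sum] }
  have hT : LinearMap.range T = ⊤ := by
    by_contra hne
    obtain ⟨f, hf, hle⟩ := Submodule.exists_le_ker_of_lt_top _ (lt_top_iff_ne_top.2 hne)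
    apply hf
    let b : Fin (r + 1) → K := fun k => f (Pi.single k 1)
    have hfv : ∀ v, f v = ∑ k, v k * b k := by
      intro v
      conv_lhs => rw [pi_eq_sum_univ' v]
      rw [map_sum]
      refine Finset.sum_congr rfl fun k _ => ?_
      rw [map_smul, smul_eq_mul]
    let A : K[X] := ∑ k : Fin (r + 1), C (b k) * X ^ (k : ℕ)
    have hAdeg : A.natDegree ≤ r := by
      refine natDegree_sum_le_of_forall_le _ _ fun k _ => ?_
      exact (natDegree_C_mul_X_pow_le _ _).trans (by omega)
    have hop : ∀ i, op A s i = ∑ k : Fin (r + 1), b k * s (i + k) := by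
      intro i
      simp only [A]
      rw [op_sum]
      refine Finset.sum_congr rfl fun k _ => ?_
      rw [op_C_mul, op_X_pow]
    have hA : A = 0 := by
      refine h A hAdeg fun i hi hi2 => ?_
      have := hle (LinearMap.mem_range_self T (Pi.single ⟨i - i1, by omega⟩ 1))
      rw [LinearMap.mem_ker, hfv] at this
      rw [hop, ← this]
      refine Finset.sum_congr rfl fun k _ => ?_
      rw [mul_comm]; congr 1
      simp only [T, LinearMap.coe_mk, AddHom.coe_mk]
      rw [Finset.sum_eq_single ⟨i - i1, by omega⟩]
      · simp; congr 1; omega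
      · intro j _ hj; simp [Pi.single_eq_of_ne hj]
      · simp
    have hb : ∀ k, b k = 0 := by
      intro k
      have : A.coeff k = b k := by
        simp only [A, finset_sum_coeff, coeff_C_mul, coeff_X_pow]
        rw [Finset.sum_eq_single k]
        · simp
        · intro j _ hj; simp [Fin.val_inj, hj.symm]
        · simp
      rw [← this, hA]; simp
    ext v
    simp [b] at hb
    simp [hb]
  have : (fun k : Fin (r + 1) => φ k) ∈ LinearMap.range T := by rw [hT]; trivial
  obtain ⟨c, hc⟩ := this
  refine ⟨∑ i : Fin (N + 1), C (c i) * X ^ (i : ℕ), ?_, ?_⟩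
  · refine natDegree_sum_le_of_forall_le _ _ fun k _ => ?_
    exact (natDegree_C_mul_X_pow_le _ _).trans (by omega)
  · intro k hk
    have := congrFun hc ⟨k, by omega⟩
    simp only [T, LinearMap.coe_mk, AddHom.coe_mk] at this
    rw [op_sum, ← this]
    refine Finset.sum_congr rfl fun i _ => ?_
    rw [op_C_mul, op_X_pow]

/-- `φ` is a combination of shifts of `s` on `[0,M]`. -/
def Gen (n M : ℕ) (s φ : ℕ → K) : Prop :=
  ∃ c : K[X], c.natDegree ≤ n - M ∧ ∀ k, k ≤ M → op c s k = φ k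

lemma op_shift (i : ℕ) (A : K[X]) (s : ℕ → K) (k : ℕ) : op (X ^ i * A) s k = op A s (k + i) := by
  rw [op_mul, op_X_pow]

lemma tri {u : ℕ → K} {i0 M : ℕ} (hM : M ≤ i0) (hu : u i0 ≠ 0)
    (h : (∀ i, i0 < i → i ≤ i0 + M → u i = 0) ∨ (∀ i, i0 ≤ i + M → i < i0 → u i = 0))
    (φ : ℕ → K) : ∃ c : K[X], c.natDegree ≤ M ∧ ∀ k, k ≤ M → op c u (i0 - M + k) = φ k := by
  refine hankel (fun A hA hz => ?_) φ
  by_contra hne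
  rcases h with h | h
  · set z := A.natTrailingDegree with hzdef
    have hzle : z ≤ M := (natTrailingDegree_le_natDegree A).trans hA
    have h1 := hz (i0 - z) (by omega) (by omega)
    rw [op_eq hA, Finset.sum_eq_single z] at h1
    · rw [Nat.sub_add_cancel (by omega)] at h1
      rcases mul_eq_zero.1 h1 with h2 | h2
      · exact hne (trailingCoeff_eq_zero.1 h2)
      · exact hu h2
    · intro k hk hkz
      rcases lt_or_gt_of_ne hkz with hlt | hgt
      · rw [coeff_eq_zero_of_lt_natTrailingDegree hlt, zero_mul]
      · rw [h _ (by omega) (by simp at hk; omega), mul_zero]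
    · intro hk; simp at hk; omega
  · set z := A.natDegree with hzdef
    have h1 := hz (i0 - z) (by omega) (by omega)
    rw [op_eq hA, Finset.sum_eq_single z] at h1
    · rw [Nat.sub_add_cancel (by omega)] at h1
      rcases mul_eq_zero.1 h1 with h2 | h2
      · exact hne (leadingCoeff_eq_zero.1 h2)
      · exact hu h2
    · intro k hk hkz
      rcases lt_or_gt_of_ne hkz with hlt | hgt
      · rw [h _ (by omega) (by omega), mul_zero]
      · rw [coeff_eq_zero_of_natDegree_lt hgt, zero_mul]
    · intro hk; simp at hk; omega

lemma tri_gen {s : ℕ → K} {B : K[X]} {i0 M D n : ℕ} (hB : B.natDegree ≤ D) (hn : i0 + D + M ≤ n)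
    (hM : M ≤ i0) (hu : op B s i0 ≠ 0)
    (h : (∀ i, i0 < i → i ≤ i0 + M → op B s i = 0) ∨ (∀ i, i0 ≤ i + M → i < i0 → op B s i = 0))
    (φ : ℕ → K) : Gen n M s φ := by
  obtain ⟨c, hc, hc2⟩ := tri hM hu h φ
  refine ⟨X ^ (i0 - M) * (c * B), ?_, fun k hk => ?_⟩
  · refine natDegree_mul_le.trans ?_
    have := natDegree_mul_le (p := c) (q := B)
    simp only [natDegree_X_pow]
    omega
  · rw [op_shift, op_mul, add_comm, hc2 k hk]

lemma op_const {A : K[X]} {u : ℕ → K} {v : K} {i D : ℕ} (hA : A.natDegree ≤ D)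
    (hu : ∀ k, k ≤ D → u (i + k) = v) : op A u i = A.eval 1 * v := by
  rw [op_eq hA, eval_eq_sum_range' (Nat.lt_succ_of_le hA), Finset.sum_mul]
  refine Finset.sum_congr rfl fun k hk => ?_
  rw [hu k (by simp at hk; omega)]; simp

lemma natDegree_X_sub_one_pow (j : ℕ) : ((X - 1 : K[X]) ^ j).natDegree = j := by
  rw [natDegree_pow, ← C_1, natDegree_X_sub_C, mul_one]

/-- `(E-1)^j` annihilates `s` on `[a,e]`. -/
def Kill (a e : ℕ) (s : ℕ → K) (j : ℕ) : Prop :=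
  ∀ i, a ≤ i → i + j ≤ e → op ((X - 1) ^ j) s i = 0

lemma dich [IsAlgClosed K] {n m a e : ℕ} (s : ℕ → K)
    (h1 : a + 4 * m + 4 ≤ e) (h2 : m ≤ a) (h3 : e + 2 * m ≤ n) :
    (∃ ω : K, ω ≠ 0 ∧ ω ≠ 1 ∧ Gen n m s (fun k => ω ^ k)) ∨ ∃ j, j ≤ m ∧ Kill a e s j := by
  classical
  obtain ⟨ω₀, hω₀⟩ : ∃ ω : K, ω ≠ 0 ∧ ω ≠ 1 := by
    haveI : Infinite K := IsAlgClosed.instInfinite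
    obtain ⟨x, hx⟩ := Infinite.exists_notMem_finset ({0, 1} : Finset K)
    simp at hx; exact ⟨x, hx⟩
  by_cases H : ∀ A : K[X], A.natDegree ≤ m → (∀ i, a ≤ i → i ≤ a + (e - m - a) → op A s i = 0) → A = 0
  · left
    obtain ⟨c, hc, hc2⟩ := hankel H (fun k => ω₀ ^ k)
    refine ⟨ω₀, hω₀.1, hω₀.2, X ^ a * c, ?_, fun k hk => ?_⟩
    · refine natDegree_mul_le.trans ?_
      simp only [natDegree_X_pow]; omega
    · rw [op_shift, add_comm, hc2 k hk]
  push Not at H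
  have Hex : ∃ r, ∃ A : K[X], A.natDegree = r ∧ r ≤ m ∧ (∀ i, a ≤ i → i + m ≤ e → op A s i = 0) ∧ A ≠ 0 := by
    obtain ⟨A, hA, hA2, hA3⟩ := H
    exact ⟨_, A, rfl, hA, fun i hi hi2 => hA2 i hi (by omega), hA3⟩
  obtain ⟨A, hAr, hrm, hAk, hA0⟩ := Nat.find_spec Hex
  have hmin : ∀ B : K[X], B.natDegree < A.natDegree → B ≠ 0 → ∃ i, a ≤ i ∧ i + m ≤ e ∧ op B s i ≠ 0 := by
    intro B hB hB0
    have := Nat.find_min Hex (m := B.natDegree) (by omega)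
    by_contra hcon
    push Not at hcon
    exact this ⟨B, rfl, by omega, hcon, hB0⟩
  rw [← hAr] at hrm
  by_cases hroot : ∃ ω : K, A.IsRoot ω ∧ ω ≠ 0 ∧ ω ≠ 1
  · left
    obtain ⟨ω, hr, hω0, hω1⟩ := hroot
    obtain ⟨B, hB⟩ := dvd_iff_isRoot.2 hr
    have hB0 : B ≠ 0 := by rintro rfl; simp at hB; exact hA0 hB
    have hdeg : A.natDegree = B.natDegree + 1 := by
      rw [hB, natDegree_mul (X_sub_C_ne_zero _) hB0, natDegree_X_sub_C, add_comm]
    have hrec : ∀ i, a ≤ i → i + m ≤ e → op B s (i + 1) = ω * op B s i := by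
      intro i hi hi2
      have := hAk i hi hi2
      rw [hB, op_X_sub_C_mul] at this
      exact sub_eq_zero.1 this
    have hpow : ∀ w, a + w + m ≤ e + 1 → op B s (a + w) = ω ^ w * op B s a := by
      intro w
      induction w with
      | zero => simp
      | succ w ih =>
        intro hw
        rw [← add_assoc, hrec _ (by omega) (by omega), ih (by omega)]; ring
    have hua : op B s a ≠ 0 := by
      intro h0
      obtain ⟨i, hi, hi2, hi3⟩ := hmin B (by omega) hB0
      apply hi3
      have := hpow (i - a) (by omega)
      rw [h0, mul_zero] at this
      rwa [Nat.add_sub_cancel' hi] at this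
    refine ⟨ω, hω0, hω1, C (op B s a)⁻¹ * (X ^ a * B), ?_, fun k hk => ?_⟩
    · refine (natDegree_C_mul_le _ _).trans (natDegree_mul_le.trans ?_)
      simp only [natDegree_X_pow]; omega
    · rw [op_C_mul, op_shift, add_comm, hpow k (by omega)]
      field_simp
  push Not at hroot
  obtain ⟨A1, hA1, hA1n⟩ := exists_eq_pow_rootMultiplicity_mul_and_not_dvd A hA0 1
  set j := A.rootMultiplicity 1
  have hA10 : A1 ≠ 0 := by rintro rfl; simp at hA1n
  obtain ⟨A2, hA2, hA2n⟩ := exists_eq_pow_rootMultiplicity_mul_and_not_dvd A1 hA10 0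
  set z := A1.rootMultiplicity 0
  have hA2c : A2.degree = 0 := by
    by_contra hne
    obtain ⟨x, hx⟩ := IsAlgClosed.exists_root A2 hne
    have hxA1 : A1.IsRoot x := by
      rw [hA2]; simp [IsRoot, IsRoot.def.1 hx]
    have hxA : A.IsRoot x := by
      rw [hA1]; simp [IsRoot, IsRoot.def.1 hxA1]
    by_cases hx0 : x = 0
    · subst hx0; exact hA2n (dvd_iff_isRoot.2 hx)
    · have := hroot x hxA hx0
      subst this; exact hA1n (dvd_iff_isRoot.2 hxA1)
  obtain ⟨cc, hcc⟩ : ∃ cc : K, A2 = C cc := ⟨_, eq_C_of_degree_eq_zero hA2c⟩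
  have hcc0 : cc ≠ 0 := by rintro rfl; simp at hcc; subst hcc; simp at hA2c
  have hAform : A = C cc * (X ^ z * (X - 1) ^ j) := by
    rw [hA1, hA2, hcc]; simp; ring
  have hAdeg : A.natDegree = z + j := by
    rw [hAform, natDegree_C_mul hcc0, natDegree_mul (by simp) (pow_ne_zero _ (by rw [← C_1]; exact X_sub_C_ne_zero _)),
      natDegree_X_sub_one_pow, natDegree_X_pow]
  have hv : ∀ i, a + z ≤ i → i + m ≤ e + z → op ((X - 1) ^ j) s i = 0 := by
    intro i hi hi2
    have := hAk (i - z) (by omega) (by omega)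
    rw [hAform, op_C_mul, op_shift, Nat.sub_add_cancel (by omega)] at this
    exact (mul_eq_zero.1 this).resolve_left hcc0
  by_cases hall : Kill a e s j
  · right; exact ⟨j, by omega, hall⟩
  left
  unfold Kill at hall
  push Not at hall
  obtain ⟨i, hi, hi2, hi3⟩ := hall
  have hdegj : ((X - 1 : K[X]) ^ j).natDegree ≤ j := (natDegree_X_sub_one_pow j).le
  refine ⟨ω₀, hω₀.1, hω₀.2, ?_⟩
  by_cases hlt : i < a + z
  · obtain ⟨i0, hi0, hmax⟩ := Finset.exists_max_image
      ((Finset.range (a + z)).filter fun i => op ((X - 1) ^ j) s i ≠ 0) id ⟨i, by simp [hlt, hi3]⟩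
    simp only [Finset.mem_filter, Finset.mem_range, id] at hi0 hmax
    have hii : i ≤ i0 := hmax i ⟨hlt, hi3⟩
    refine tri_gen (B := (X - 1) ^ j) (i0 := i0) hdegj (by omega) (by omega) hi0.2 (Or.inl fun i' h h' => ?_) _
    by_cases hi'z : i' < a + z
    · by_contra hne
      have := hmax i' ⟨hi'z, hne⟩; omega
    · exact hv i' (by omega) (by omega)
  · have hgt : e + z < i + m := by
      by_contra hc
      exact hi3 (hv i (by omega) (by omega))
    have hex : ∃ i, a + z ≤ i ∧ op ((X - 1) ^ j) s i ≠ 0 := ⟨i, by omega, hi3⟩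
    obtain ⟨hf1, hf2⟩ := Nat.find_spec hex
    have hle : Nat.find hex ≤ i := Nat.find_min' hex ⟨by omega, hi3⟩
    have hge : e + z < Nat.find hex + m := by
      by_contra hc
      exact hf2 (hv _ hf1 (by omega))
    refine tri_gen (B := (X - 1) ^ j) (i0 := Nat.find hex) hdegj (by omega) (by omega) hf2 (Or.inr fun i' h h' => ?_) _
    have := Nat.find_min hex h'
    push Not at this
    exact this (by omega)

/-- all functions on intervals of length `j` -/
lemma gen_interval {a e j i1 : ℕ} {s : ℕ → K} (hj : 1 ≤ j) (hk : Kill a e s j)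
    (hmin : ¬ Kill a e s (j - 1)) (ha : a ≤ i1) (he : i1 + 3 * j ≤ e) (φ : ℕ → K) :
    ∃ c : K[X], c.natDegree ≤ j - 1 ∧ ∀ k, k ≤ j - 1 → op c s (i1 + k) = φ k := by
  refine hankel (fun A hA hz => ?_) φ
  by_contra hne
  obtain ⟨A1, hA1, hA1n⟩ := exists_eq_pow_rootMultiplicity_mul_and_not_dvd A hne 1
  set j' := A.rootMultiplicity 1
  have hA10 : A1 ≠ 0 := by rintro rfl; simp at hA1n
  have hdeg : A.natDegree = j' + A1.natDegree := by
    conv_lhs => rw [hA1]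
    rw [natDegree_mul (pow_ne_zero _ (X_sub_C_ne_zero _)) hA10, natDegree_pow, natDegree_X_sub_C, mul_one]
  set u := op ((X - 1) ^ (j - 1)) s with hu
  have hconst : ∀ k, a + k + j ≤ e + 1 → u (a + k) = u a := by
    intro k
    induction k with
    | zero => simp
    | succ k ih =>
      intro hk'
      rw [← ih (by omega)]
      have := hk (a + k) (by omega) (by omega)
      have e1 : (X - 1 : K[X]) ^ j = (X - C 1) * (X - 1) ^ (j - 1) := by
        rw [C_1, ← pow_succ']; congr 1; omega
      rw [e1, op_X_sub_C_mul, one_mul] at this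
      rw [← add_assoc]
      exact sub_eq_zero.1 this
  have hzero : op A1 u i1 = 0 := by
    have h1 : op ((X - 1) ^ (j - 1 - j')) (op A s) i1 = 0 := by
      apply op_zero_on (D := j - 1) ((natDegree_X_sub_one_pow _).le.trans (by omega))
      intro k hk'
      exact hz _ (by omega) (by omega)
    rw [← op_mul] at h1
    rw [hu, ← op_mul, ← h1]
    congr 1
    conv_rhs => rw [hA1]
    rw [C_1, ← mul_assoc, ← pow_add, mul_comm]
    congr 3; omega
  rw [op_const (D := j - 1) (v := u a) (by omega)] at hzero
  · rcases mul_eq_zero.1 hzero with h | h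
    · exact hA1n (dvd_iff_isRoot.2 h)
    · apply hmin
      intro i hi hi2
      have := hconst (i - a) (by omega)
      rw [Nat.add_sub_cancel' hi, h] at this
      exact this
  · intro k hk'
    have := hconst (i1 + k - a) (by omega)
    rwa [Nat.add_sub_cancel' (by omega)] at this

lemma rec_zero {A : K[X]} (hA : A.Monic) {v : ℕ → K} {a E : ℕ}
    (hz : ∀ i, a ≤ i → i + A.natDegree ≤ E → op A v i = 0)
    (h0 : ∀ i, a ≤ i → i < a + A.natDegree → v i = 0) :
    ∀ i, a ≤ i → i ≤ E → v i = 0 := by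
  intro i
  induction i using Nat.strong_induction_on with
  | _ i ih =>
    intro hi hiE
    by_cases hlt : i < a + A.natDegree
    · exact h0 i hi hlt
    · have h1 := hz (i - A.natDegree) (by omega) (by omega)
      rw [op_eq le_rfl, Finset.sum_range_succ, Finset.sum_eq_zero, zero_add, hA.coeff_natDegree, one_mul,
        Nat.sub_add_cancel (by omega)] at h1
      · exact h1
      · intro k hk
        simp at hk
        rw [ih _ (by omega) (by omega) (by omega), mul_zero]

lemma op_expand (q i0 : ℕ) (A : K[X]) (s : ℕ → K) (y : ℕ) :
    op A (fun y => s (i0 + q * y)) y = op (expand K q A) s (i0 + q * y) := by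
  induction A using Polynomial.induction_on' with
  | add A B hA hB => 
    have h1 : ∀ (A B : K[X]) (s : ℕ → K) i, op (A + B) s i = op A s i + op B s i := by
      intros; simp [op]
    rw [map_add, h1, h1, hA, hB]
  | monomial n c =>
    rw [← C_mul_X_pow_eq_monomial, map_mul, map_pow, expand_C, expand_X, op_C_mul, op_C_mul, op_X_pow,
      ← pow_mul, op_X_pow]
    congr 2; ring

/-- Boolean valued low degree sequences are constant. -/
lemma poly_const {k : ℕ} (hk : 2 ≤ k) {t : ℕ → K} (hb : ∀ i, t i = 0 ∨ t i = 1)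
    (hz : ∀ i, i + k ≤ 2 * k - 2 → op ((X - 1) ^ k) t i = 0)
    (hchar : ∀ x : ℕ, 0 < x → x ≤ 2 * k - 2 → (x : K) ≠ 0) : t 0 = t 1 := by
  classical
  have hz2 : ∀ l, k ≤ l → l ≤ 2 * k - 2 → op ((X - 1) ^ l) t 0 = 0 := by
    intro l hl hl2
    have e : (X - 1 : K[X]) ^ l = (X - 1) ^ (l - k) * (X - 1) ^ k := by
      rw [← pow_add]; congr 1; omega
    rw [e, op_mul]
    apply op_zero_on (natDegree_X_sub_one_pow _).le
    intro i hi; exact hz _ (by omega)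
  have hfact : ∀ l, l < k → (l.factorial : K) ≠ 0 := by
    intro l hl
    induction l with
    | zero => simp
    | succ l ih =>
      rw [Nat.factorial_succ, Nat.cast_mul]
      exact mul_ne_zero (hchar _ (by omega) (by omega)) (ih (by omega))
  let P : K[X] := ∑ l ∈ Finset.range k, C (op ((X - 1) ^ l) t 0 / l.factorial) * descPochhammer K l
  have hPdeg : P.natDegree ≤ k - 1 := by
    refine natDegree_sum_le_of_forall_le _ _ fun l hl => ?_
    refine (natDegree_C_mul_le _ _).trans ?_
    rw [descPochhammer_natDegree]; simp at hl; omega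
  have hP : ∀ y, y ≤ 2 * k - 2 → t y = P.eval (y : K) := by
    intro y hy
    have h1 : t y = op (X ^ y) t 0 := by rw [op_X_pow, zero_add]
    have h2 : (X : K[X]) ^ y = ∑ l ∈ Finset.range (y + 1), C (y.choose l : K) * (X - 1) ^ l := by
      have : (X : K[X]) = (X - 1) + 1 := by ring
      conv_lhs => rw [this, add_pow]
      refine Finset.sum_congr rfl fun l _ => ?_
      simp [mul_comm]
    rw [h1, h2, op_sum]
    simp only [P, eval_finset_sum, eval_mul, eval_C, descPochhammer_eval_eq_descFactorial, op_C_mul]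
    have h3 : ∀ l, l < k → op ((X - 1) ^ l) t 0 / (l.factorial : K) * (y.descFactorial l : K) = (y.choose l : K) * op ((X - 1) ^ l) t 0 := by
      intro l hl
      rw [Nat.descFactorial_eq_factorial_mul_choose]
      have := hfact l hl
      push_cast
      field_simp
    rw [Finset.sum_congr rfl fun l hl => h3 l (by simpa using hl)]
    have hA : ∑ l ∈ Finset.range (y + 1), (y.choose l : K) * op ((X - 1) ^ l) t 0 =
        ∑ l ∈ Finset.range (y + 1 + k), (y.choose l : K) * op ((X - 1) ^ l) t 0 := by
      refine Finset.sum_subset (by intro l; simp; omega) fun l _ hl => ?_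
      rw [Nat.choose_eq_zero_of_lt (by simp at hl; omega)]; simp
    have hB : ∑ l ∈ Finset.range k, (y.choose l : K) * op ((X - 1) ^ l) t 0 =
        ∑ l ∈ Finset.range (y + 1 + k), (y.choose l : K) * op ((X - 1) ^ l) t 0 := by
      refine Finset.sum_subset (by intro l; simp; omega) fun l _ hl => ?_
      by_cases hly : l ≤ y
      · rw [hz2 l (by simp at hl; omega) (by omega), mul_zero]
      · rw [Nat.choose_eq_zero_of_lt (by omega)]; simp
    rw [hA, hB]
  have hinj : ∀ x y : ℕ, x ≤ 2 * k - 2 → y ≤ 2 * k - 2 → (x : K) = y → x = y := by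
    have : ∀ x y : ℕ, x < y → y ≤ 2 * k - 2 → (x : K) ≠ y := by
      intro x y hxy hy he
      apply hchar (y - x) (by omega) (by omega)
      rw [Nat.cast_sub hxy.le, he, sub_self]
    intro x y hx hy he
    rcases lt_trichotomy x y with h | h | h
    · exact absurd he (this x y h hy)
    · exact h
    · exact absurd he.symm (this y x h hx)
  have hval : ∃ v : K, k ≤ ((Finset.range (2 * k - 1)).filter fun y => t y = v).card := by
    by_contra hcon
    push Not at hcon
    have h0 := hcon 0
    have h1 := hcon 1
    have : (Finset.range (2 * k - 1)) ⊆ ((Finset.range (2 * k - 1)).filter fun y => t y = 0) ∪ ((Finset.range (2 * k - 1)).filter fun y => t y = 1) := by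
      intro y hy
      rcases hb y with h | h
      · exact Finset.mem_union_left _ (by simp [h]; simpa using hy)
      · exact Finset.mem_union_right _ (by simp [h]; simpa using hy)
    have := (Finset.card_le_card this).trans (Finset.card_union_le _ _)
    simp only [Finset.card_range] at this
    omega
  obtain ⟨v, hv⟩ := hval
  have hPv : P - C v = 0 := by
    set S := ((Finset.range (2 * k - 1)).filter fun y => t y = v)
    have hcard : (S.image (fun y : ℕ => (y : K))).card = S.card := by
      apply Finset.card_image_of_injOn
      intro x hx y hy he
      simp [S] at hx hy
      exact hinj x y (by omega) (by omega) he
    refine eq_zero_of_natDegree_lt_card_of_eval_eq_zero' (P - C v) (S.image (fun y : ℕ => (y : K))) ?_ ?_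
    · intro x hx
      obtain ⟨y, hy, rfl⟩ := Finset.mem_image.1 hx
      simp [S] at hy
      rw [eval_sub, eval_C, ← hP y (by omega), hy.2, sub_self]
    · rw [hcard]
      have := natDegree_sub_C (p := P) (a := v)
      omega
  have hPv' : P = C v := sub_eq_zero.1 hPv
  rw [hP 0 (by omega), hP 1 (by omega), hPv', eval_C, eval_C]

/-- core step of the period analysis -/
lemma step_kill {a e j q k : ℕ} {s : ℕ → K} (hb : ∀ i, s i = 0 ∨ s i = 1)
    (hq : (X - 1 : K[X]) ^ q = X ^ q - 1) (hq1 : 1 ≤ q) (hqj : q < j) (hk2 : 2 ≤ k)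
    (hk1 : (k - 1) * q < j) (hjk : j ≤ k * q)
    (hchar : ∀ x : ℕ, 0 < x → x ≤ 2 * k - 2 → (x : K) ≠ 0)
    (hkill : Kill a e s j) (hlen : a + 3 * j ≤ e) : Kill a e s q := by
  have hper : ∀ i0, a ≤ i0 → i0 + (2 * k - 2) * q ≤ e → s i0 = s (i0 + q) := by
    intro i0 hi0 hi0e
    have := poly_const hk2 (t := fun y => s (i0 + q * y)) (fun i => hb _) (fun y hy => ?_) hchar
    · simpa using this
    · rw [op_expand]
      have e1 : expand K q ((X - 1) ^ k) = (X - 1) ^ (k * q - j) * (X - 1) ^ j := by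
        rw [← pow_add, Nat.sub_add_cancel hjk, mul_comm, pow_mul, hq]
        simp
      rw [e1, op_mul]
      apply op_zero_on (natDegree_X_sub_one_pow _).le
      intro l hl
      have : q * y + k * q ≤ (2 * k - 2) * q := by
        calc q * y + k * q = (y + k) * q := by ring
          _ ≤ _ := Nat.mul_le_mul_right _ hy
      exact hkill _ (by omega) (by omega)
  have h2q : (2 * k - 2) * q < 2 * j := by
    have : (2 * k - 2) * q = 2 * ((k - 1) * q) := by
      rw [← mul_assoc]; congr 1; omega
    omega
  have hmon : ((X - 1 : K[X]) ^ (j - q)).Monic := by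
    rw [← C_1]; exact (monic_X_sub_C _).pow _
  have := rec_zero hmon (v := op ((X - 1) ^ q) s) (a := a) (E := e - q) (fun i hi hi2 => ?_) (fun i hi hi2 => ?_)
  · intro i hi hi2
    exact this i hi (by omega)
  · rw [natDegree_X_sub_one_pow] at hi2
    rw [← op_mul, ← pow_add, Nat.sub_add_cancel hqj.le]
    exact hkill i hi (by omega)
  · rw [natDegree_X_sub_one_pow] at hi2
    rw [hq, op_sub, op_X_pow]
    have h1 : op (1 : K[X]) s i = s i := by simp [op]
    rw [h1, ← hper i hi (by omega), sub_self]

lemma period_char {p : ℕ} [CharP K p] (hp : p = 0 ∨ p.Prime) {a e j : ℕ} {s : ℕ → K}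
    (hb : ∀ i, s i = 0 ∨ s i = 1) (hj : 2 ≤ j) (hkill : Kill a e s j)
    (hmin : ∀ j', j' < j → ¬ Kill a e s j') (hlen : a + 3 * j ≤ e) :
    p.Prime ∧ ∃ τ, p ^ τ ≤ 2 * j ∧ ∀ i, a ≤ i → i + p ^ τ ≤ e → s i = s (i + p ^ τ) := by
  rcases hp with rfl | hp
  · exfalso
    haveI : CharZero K := CharP.charP_to_charZero K
    refine hmin 1 (by omega) (step_kill (k := j) hb (by simp) le_rfl (by omega) hj (by omega) (by omega) ?_ hkill hlen)
    intro x hx _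
    exact_mod_cast hx.ne'
  · refine ⟨hp, ?_⟩
    haveI : Fact p.Prime := ⟨hp⟩
    have hex : ∃ τ, j ≤ p ^ τ := ⟨j, (Nat.lt_pow_self hp.one_lt).le⟩
    set τ := Nat.find hex
    have hτ : j ≤ p ^ τ := Nat.find_spec hex
    have hτ0 : τ ≠ 0 := by
      intro h; rw [h] at hτ; simp at hτ; omega
    obtain ⟨σ, hσ⟩ := Nat.exists_eq_succ_of_ne_zero hτ0
    have hσj : p ^ σ < j := by
      have := Nat.find_min hex (m := σ) (by omega)
      omega
    have hq : ∀ r, (X - 1 : K[X]) ^ (p ^ r) = X ^ (p ^ r) - 1 := by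
      intro r
      rw [sub_pow_char_pow, one_pow]
    have hq1 : 1 ≤ p ^ σ := Nat.one_le_pow _ _ hp.pos
    have hk : ∃ k, 2 ≤ k ∧ (k - 1) * p ^ σ < j ∧ j ≤ k * p ^ σ := by
      refine ⟨(j - 1) / p ^ σ + 1, ?_, ?_, ?_⟩
      · have := (Nat.one_le_div_iff (by omega)).2 (show p ^ σ ≤ j - 1 by omega)
        omega
      · have := Nat.div_mul_le_self (j - 1) (p ^ σ)
        simp only [Nat.add_sub_cancel]
        omega
      · have := Nat.lt_div_mul_add (a := j - 1) (b := p ^ σ) (by omega)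
        rw [add_mul, one_mul]; omega
    obtain ⟨k, hk2, hk1, hjk⟩ := hk
    have hpk : p ≤ 2 * k - 2 := by
      by_contra hc
      refine hmin _ hσj (step_kill (k := k) hb (hq σ) hq1 hσj hk2 hk1 hjk ?_ hkill hlen)
      intro x hx hx2 h0
      rw [CharP.cast_eq_zero_iff K p] at h0
      have := Nat.le_of_dvd hx h0
      omega
    have hle : p ^ τ ≤ 2 * j := by
      calc p ^ τ = p * p ^ σ := by rw [hσ, pow_succ, mul_comm]
        _ ≤ (2 * k - 2) * p ^ σ := Nat.mul_le_mul_right _ hpk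
        _ = 2 * ((k - 1) * p ^ σ) := by rw [← mul_assoc]; congr 1; omega
        _ ≤ 2 * j := by omega
    refine ⟨τ, hle, fun i hi hie => ?_⟩
    have h0 : op ((X - 1) ^ (p ^ τ)) s i = 0 := by
      have : (X - 1 : K[X]) ^ (p ^ τ) = (X - 1) ^ (p ^ τ - j) * (X - 1) ^ j := by
        rw [← pow_add, Nat.sub_add_cancel hτ]
      rw [this, op_mul]
      apply op_zero_on (natDegree_X_sub_one_pow _).le
      intro l hl
      exact hkill _ (by omega) (by omega)
    rw [hq, op_sub, op_X_pow] at h0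
    have h1 : op (1 : K[X]) s i = s i := by simp [op]
    rw [h1] at h0
    exact (sub_eq_zero.1 h0).symm

end alg


lemma exact_poly (F : Type) [Field F] {n : ℕ} (f : (Fin n → Bool) → Bool) :
    ∃ P : MvPolynomial (Fin n) F, ∀ a, MvPolynomial.eval (fun v => bF F (a v)) P = bF F (f a) := by
  classical
  refine ⟨∑ b : Fin n → Bool, MvPolynomial.C (bF F (f b)) *
    ∏ v, (if b v then MvPolynomial.X v else 1 - MvPolynomial.X v), fun a => ?_⟩
  rw [map_sum, Finset.sum_eq_single a]
  · rw [map_mul, map_prod, MvPolynomial.eval_C, Finset.prod_eq_one, mul_one]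
    intro v _
    cases h : a v <;> simp [bF, h]
  · intro b _ hb
    obtain ⟨v, hv⟩ := Function.ne_iff.mp hb
    rw [map_mul, map_prod, Finset.prod_eq_zero (Finset.mem_univ v), mul_zero]
    cases h : a v <;> cases h' : b v <;> simp_all [bF]
  · simp

lemma pdeg_comp (F K : Type) [Field F] [Field K] [Algebra F K] {n : ℕ} {f : (Fin n → Bool) → Bool}
    {specF : ℕ → Bool} (hf : ∀ a, f a = specF (wt a)) {ε : ℝ} (hε : 0 < ε) :
    Comp K n (pdeg F f ε) ε (fun i => bF K (specF i)) := by
  classical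
  have hne : {d | ∃ P : ProbPoly F n, (∀ i, (P.poly i).totalDegree ≤ d) ∧
      ∀ a, errAt P f a ≤ ε}.Nonempty := by
    obtain ⟨P, hP⟩ := exact_poly F f
    refine ⟨P.totalDegree, ⟨1, fun _ => 1, by simp, by simp, fun _ => P⟩, by simp, fun a => ?_⟩
    simp [errAt, hP, hε.le]
  obtain ⟨P, hd, he⟩ := Nat.sInf_mem hne
  refine ⟨Fin P.k, inferInstance, P.w, fun i a => algebraMap F K
    (MvPolynomial.eval (fun v => bF F (a v)) (P.poly i)), P.w_nonneg, P.w_sum,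
    fun i => deg_poly _ _ (hd i), fun x => ?_⟩
  have := he x
  unfold errAt at this
  refine le_trans (le_of_eq (Finset.sum_congr rfl fun i _ => ?_)) this
  have hb : bF K (specF (wt x)) = algebraMap F K (bF F (f x)) := by
    rw [hf]; unfold bF; split_ifs <;> simp
  simp only [hb, (algebraMap F K).injective.eq_iff]

lemma deg_zero_const {K : Type} [Field K] {N : ℕ} {g : (Fin N → Bool) → K}
    (hg : g ∈ DegSub K N 0) (x y : Fin N → Bool) : g x = g y := by
  induction hg using Submodule.span_induction with
  | mem g h =>
    obtain ⟨T, hT, rfl⟩ := h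
    have : T = ∅ := Finset.card_eq_zero.mp (by omega)
    subst this
    simp [chi]
  | zero => rfl
  | add _ _ _ _ h1 h2 => simp [h1, h2]
  | smul _ _ _ h => simp [h]

lemma exists_wt {n i : ℕ} (h : i ≤ n) : ∃ x : Fin n → Bool, wt x = i := by
  refine ⟨fun v => decide (v.val < i), ?_⟩
  unfold wt
  simp only [decide_eq_true_eq]
  rw [Fin.card_filter_val_lt]
  omega

lemma comp_zero_false {K : Type} [Field K] {n : ℕ} {ε : ℝ} {s : ℕ → K} (h : Comp K n 0 ε s)
    (h3 : ε ≤ 1/3) {i j : ℕ} (hi : i ≤ n) (hj : j ≤ n) (hne : s i ≠ s j) : False := by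
  classical
  obtain ⟨ι, _, w, G, h0, h1, hG, he⟩ := h
  obtain ⟨x, rfl⟩ := exists_wt hi
  obtain ⟨y, rfl⟩ := exists_wt hj
  have hx := he x
  have hy := he y
  have : (1:ℝ) ≤ ∑ i, (if G i x = s (wt x) then 0 else w i) +
      ∑ i, (if G i y = s (wt y) then 0 else w i) := by
    rw [← h1, ← Finset.sum_add_distrib]
    refine Finset.sum_le_sum fun i _ => ?_
    have := deg_zero_const (hG i) x y
    have := h0 i
    split_ifs with ha hb
    · exact absurd (ha.symm.trans (by rwa [deg_zero_const (hG i) x y])) hne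
    all_goals linarith
  have hx' : ∑ i, (if G i x = s (wt x) then 0 else w i) ≤ ε := by convert hx
  have hy' : ∑ i, (if G i y = s (wt y) then 0 else w i) ≤ ε := by convert hy
  linarith


lemma period_spec (n : ℕ) (g : ℕ → Bool) :
    1 ≤ period n g ∧ ∀ i, i + period n g ≤ n → g i = g (i + period n g) := by
  have hne : {b | 1 ≤ b ∧ ∀ i, i + b ≤ n → g i = g (i + b)}.Nonempty :=
    ⟨n + 1, by omega, fun i hi => by omega⟩
  exact Nat.sInf_mem hne

lemma mod_core {f : ℕ → Bool} {a e q : ℕ} (hq : 1 ≤ q)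
    (h : ∀ i, a ≤ i → i + q ≤ e → f i = f (i + q)) (t : ℕ) (ht : a + t ≤ e) :
    f (a + t % q) = f (a + t) := by
  induction t using Nat.strong_induction_on with
  | _ t ih =>
    by_cases hlt : t < q
    · rw [Nat.mod_eq_of_lt hlt]
    · have h1 := ih (t - q) (by omega) (by omega)
      have h2 := h (a + (t - q)) (by omega) (by omega)
      rw [Nat.mod_eq_sub_mod (by omega), h1, h2]
      congr 1; omega

lemma period_le_core {n a e : ℕ} {f : ℕ → Bool} {b : ℕ}
    (hmin : ∀ g' : ℕ → Bool, (∀ i, a ≤ i → i ≤ e → g' i = f i) → b ≤ period n g')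
    {q : ℕ} (hq : 1 ≤ q) (h : ∀ i, a ≤ i → i + q ≤ e → f i = f (i + q)) : b ≤ q := by
  have ha : a ≤ q * a := Nat.le_mul_of_pos_left a hq
  refine (hmin (fun i => f (a + (i + (q * a - a)) % q)) ?_).trans ?_
  · intro i h1 h2
    obtain ⟨t, rfl⟩ := Nat.exists_eq_add_of_le h1
    have : a + t + (q * a - a) = t + q * a := by omega
    simp only [this, Nat.add_mul_mod_self_left]
    exact mod_core hq h t h2
  · refine Nat.sInf_le ⟨hq, fun i _ => ?_⟩
    have : i + q + (q * a - a) = (i + (q * a - a)) + q := by omega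
    simp only [this, Nat.add_mod_right]

lemma period_dvd {a e b : ℕ} {f : ℕ → Bool} (hb1 : 1 ≤ b)
    (hb : ∀ i, a ≤ i → i + b ≤ e → f i = f (i + b))
    (hmin : ∀ q, 1 ≤ q → (∀ i, a ≤ i → i + q ≤ e → f i = f (i + q)) → b ≤ q)
    (q : ℕ) (hq : 1 ≤ q) (h : ∀ i, a ≤ i → i + q ≤ e → f i = f (i + q))
    (hlen : a + 2 * q ≤ e) : b ∣ q := by
  induction q using Nat.strong_induction_on with
  | _ q ih =>
    have hbq := hmin q hq h
    rcases hbq.eq_or_lt with h0 | hlt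
    · rw [h0]
    · have := ih (q - b) (by omega) (by omega) (fun i h1 h2 => ?_) (by omega)
      · have h3 := Nat.dvd_add this (dvd_refl b)
        rwa [Nat.sub_add_cancel hbq] at h3
      · by_cases hc : i + q ≤ e
        · have e1 := h i h1 hc
          have e2 := hb (i + (q - b)) (by omega) (by omega)
          rw [e1, e2]; congr 1; omega
        · have e1 := hb (i - b) (by omega) (by omega)
          have e2 := h (i - b) (by omega) (by omega)
          have e3 : i - b + b = i := by omega
          have e4 : i - b + q = i + (q - b) := by omega
          rw [e3] at e1; rw [e4] at e2
          rw [← e1, e2]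

/-- structure of the exceptional part -/
lemma Bparam_facts {n : ℕ} (hn : 1000 ≤ n) {f g : ℕ → Bool}
    (hG : ∀ i, (n + 2) / 3 ≤ i → i ≤ 2 * n / 3 → g i = f i)
    (hB : 1 ≤ Bparam n (fun i => Bool.xor (f i) (g i))) :
    Bparam n (fun i => Bool.xor (f i) (g i)) ≤ (n + 2) / 3 ∧
    (∀ i, Bparam n (fun i => Bool.xor (f i) (g i)) ≤ i →
      i + Bparam n (fun i => Bool.xor (f i) (g i)) ≤ n → f i = g i) ∧
    (f (Bparam n (fun i => Bool.xor (f i) (g i)) - 1) ≠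
      g (Bparam n (fun i => Bool.xor (f i) (g i)) - 1) ∨
     f (n + 1 - Bparam n (fun i => Bool.xor (f i) (g i))) ≠
      g (n + 1 - Bparam n (fun i => Bool.xor (f i) (g i)))) := by
  set h := fun i => Bool.xor (f i) (g i) with hh
  have hcore : ∀ i, (n + 2) / 3 ≤ i → i ≤ 2 * n / 3 → h i = false := by
    intro i h1 h2; simp [hh, hG i h1 h2]
  have hmem : (n + 2) / 3 ∈ {k | ∀ i j, k ≤ i → i + k ≤ n → k ≤ j → j + k ≤ n → h i = h j} := by
    intro i j h1 h2 h3 h4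
    rw [hcore i h1 (by omega), hcore j h3 (by omega)]
  have hle : Bparam n h ≤ (n + 2) / 3 := Nat.sInf_le hmem
  have hs : Bparam n h ∈ {k | ∀ i j, k ≤ i → i + k ≤ n → k ≤ j → j + k ≤ n → h i = h j} :=
    Nat.sInf_mem ⟨_, hmem⟩
  have hz : ∀ i, Bparam n h ≤ i → i + Bparam n h ≤ n → h i = false := by
    intro i h1 h2
    rw [hs i ((n + 2) / 3) h1 h2 hle (by omega)]
    exact hcore _ le_rfl (by omega)
  refine ⟨hle, fun i h1 h2 => ?_, ?_⟩
  · have := hz i h1 h2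
    simpa [hh] using this
  · by_contra hcon
    push Not at hcon
    have hz' : ∀ i, Bparam n h - 1 ≤ i → i + (Bparam n h - 1) ≤ n → h i = false := by
      intro i h1 h2
      by_cases c1 : i = Bparam n h - 1
      · rw [c1]; simp [hh]; exact hcon.1
      by_cases c2 : i = n + 1 - Bparam n h
      · rw [c2]; simp [hh]; exact hcon.2
      exact hz i (by omega) (by omega)
    have : Bparam n h ≤ Bparam n h - 1 := Nat.sInf_le (fun i j h1 h2 h3 h4 => by
      rw [hz' i h1 h2, hz' j h3 h4])
    omega


section bounds
variable {K : Type} [Field K]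

/-- amplified computation data -/
structure Data (K : Type) [Field K] (n d : ℕ) (L : ℝ) (s : ℕ → K) : Prop where
  comp : ∃ δ : ℝ, Comp K n d δ s ∧ ((n:ℝ) + 1) * δ ≤ Real.exp (-(16 * L))
  hL : 1 ≤ L
  hn : (n:ℝ) + 1 ≤ Real.exp L

open Classical in
lemma use_bad {n d M : ℕ} {L : ℝ} {s : ℕ → K} (D : Data K n d L s) {ω : K} (h0 : ω ≠ 0)
    (h1 : ω ≠ 1) (hM1 : 1 ≤ M) (hMn : M ≤ n) {c : K[X]} (hc : c.natDegree ≤ n - M)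
    (hbad : ((Finset.univ.filter fun x : Fin M → Bool => op c s (wt x) ≠ ω ^ wt x).card : ℝ) ≤
      2 * 2 ^ M * Real.exp (-(16 * L))) :
    (M:ℝ) ≤ 8 * (d + 1) ∨ L * M ≤ ((d:ℝ) + 1) ^ 2 := by
  classical
  obtain ⟨δ, hC, hδ⟩ := D.comp
  have h := comp_shift hMn hC c hc
  have hMn' : (M:ℝ) + 1 ≤ Real.exp L := by
    have : (M:ℝ) ≤ n := by exact_mod_cast hMn
    linarith [D.hn]
  rcases smol_main h0 h1 h hM1 D.hL hδ hMn' (by convert hbad) with h | h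
  · left
    have : (M:ℝ) ≤ ((8 * (d + 1) : ℕ) : ℝ) := by exact_mod_cast h.le
    push_cast at this
    exact this
  · right; exact h

lemma wt_le {M : ℕ} (x : Fin M → Bool) : wt x ≤ M := by
  unfold wt
  exact (Finset.card_le_univ _).trans (by simp)

lemma use_gen {n d M : ℕ} {L : ℝ} {s : ℕ → K} (D : Data K n d L s) {ω : K} (h0 : ω ≠ 0)
    (h1 : ω ≠ 1) (hM1 : 1 ≤ M) (hMn : M ≤ n) (hg : Gen n M s (fun k => ω ^ k)) :
    (M:ℝ) ≤ 8 * (d + 1) ∨ L * M ≤ ((d:ℝ) + 1) ^ 2 := by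
  classical
  obtain ⟨c, hc, hcv⟩ := hg
  refine use_bad D h0 h1 hM1 hMn hc ?_
  rw [Finset.filter_eq_empty_iff.mpr]
  · simp; positivity
  · intro x _
    simp [hcv _ (wt_le x)]

lemma sqrt_bound {n m d : ℕ} {L ℓ : ℝ} (hℓ1 : 1 ≤ ℓ) (hℓL : ℓ ≤ L) (hℓn : ℓ ≤ n)
    (hm : (n:ℝ) ≤ 120 * m)
    (h : (m:ℝ) ≤ 8 * (d + 1) ∨ L * m ≤ ((d:ℝ) + 1) ^ 2) :
    Real.sqrt (n * ℓ) ≤ 1000 * ((d:ℝ) + 1) := by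
  have hd : (0:ℝ) ≤ d := Nat.cast_nonneg d
  have hn0 : (0:ℝ) ≤ n := Nat.cast_nonneg n
  have hm0 : (0:ℝ) ≤ m := Nat.cast_nonneg m
  apply Real.sqrt_le_iff.mpr
  refine ⟨by positivity, ?_⟩
  rcases h with h | h
  · have h1 : (n:ℝ) ≤ 1000 * (d + 1) := by linarith
    nlinarith
  · nlinarith [mul_le_mul hm hℓL (by linarith) (by positivity)]

lemma kill_gen {n a e m j M : ℕ} {s : ℕ → K} (hn : 1000 ≤ n) (ha : a = (n + 2) / 3)
    (he : e = 2 * n / 3) (hm : m = n / 60) (hj : 1 ≤ j) (hjm : j ≤ m) (hMm : M ≤ m)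
    (hk : Kill a e s j) (hmin : ¬ Kill a e s (j - 1)) (ω : K) :
    ∃ c : K[X], c.natDegree ≤ n - M ∧
      ∀ k, (M - j) / 2 ≤ k → k < (M - j) / 2 + j → op c s k = ω ^ k := by
  obtain ⟨c, hc, hv⟩ := gen_interval hj hk hmin (i1 := a + (M - j) / 2) (by omega) (by omega)
    (fun k => ω ^ ((M - j) / 2 + k))
  refine ⟨X ^ a * c, ?_, fun k h1 h2 => ?_⟩
  · refine natDegree_mul_le.trans ?_
    rw [natDegree_X_pow]
    omega
  · rw [op_shift]
    have := hv (k - (M - j) / 2) (by omega)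
    rw [show k + a = a + (M - j) / 2 + (k - (M - j) / 2) by omega, this]
    congr 1; omega

lemma exists_omega [IsAlgClosed K] : ∃ ω : K, ω ≠ 0 ∧ ω ≠ 1 := by
  classical
  haveI := IsAlgClosed.instInfinite (K := K)
  obtain ⟨ω, h⟩ := Infinite.exists_notMem_finset ({0, 1} : Finset K)
  exact ⟨ω, by aesop, by aesop⟩

lemma kill_bound [IsAlgClosed K] {n a e m j d : ℕ} {L ℓ : ℝ} {s : ℕ → K} (D : Data K n d L s)
    (hℓ1 : 1 ≤ ℓ) (hℓL : ℓ ≤ L) (hℓn : ℓ ≤ n)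
    (hn : 1000 ≤ n) (ha : a = (n + 2) / 3)
    (he : e = 2 * n / 3) (hm : m = n / 60) (hj : 2 ≤ j) (hjm : j ≤ m)
    (hk : Kill a e s j) (hmin : ¬ Kill a e s (j - 1)) :
    Real.sqrt (n * ℓ) ≤ 1000 * ((d:ℝ) + 1) ∨ (j:ℝ) ≤ 40 * ((d:ℝ) + 1) := by
  classical
  obtain ⟨ω, h0, h1⟩ := exists_omega (K := K)
  have hd : (0:ℝ) ≤ d := Nat.cast_nonneg d
  have hL := D.hL
  have hj' : (2:ℝ) ≤ j := by exact_mod_cast hj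
  by_cases hsmall : (j:ℝ) ≤ 128 * L
  · right
    obtain ⟨c, hc, hv⟩ := kill_gen (M := j - 1) hn ha he hm (by omega) hjm (by omega) hk hmin ω
    have := use_gen D h0 h1 (M := j - 1) (by omega) (by omega)
      ⟨c, hc, fun k hk => hv k (by omega) (by omega)⟩
    rw [Nat.cast_sub (by omega)] at this
    push_cast at this
    rcases this with h | h
    · linarith
    · have h2 : (j:ℝ) * (j / 2) ≤ (128 * L) * (j - 1) :=
        mul_le_mul hsmall (by linarith) (by linarith) (by linarith)
      have h3 : (j:ℝ) ^ 2 ≤ 256 * ((d:ℝ) + 1) ^ 2 := by nlinarith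
      nlinarith
  · push Not at hsmall
    set M := min m ⌊(j:ℝ) ^ 2 / (128 * L)⌋₊ with hM
    have hfl : j ≤ ⌊(j:ℝ) ^ 2 / (128 * L)⌋₊ := by
      apply Nat.le_floor
      rw [le_div_iff₀ (by linarith)]
      nlinarith
    have hMj : j ≤ M := le_min hjm hfl
    have hMm : M ≤ m := min_le_left _ _
    have hMu : (M:ℝ) * (128 * L) ≤ (j:ℝ) ^ 2 := by
      have : (M:ℝ) ≤ (j:ℝ) ^ 2 / (128 * L) :=
        (Nat.cast_le.mpr (min_le_right _ _)).trans (Nat.floor_le (by positivity))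
      rwa [le_div_iff₀ (by linarith)] at this
    obtain ⟨c, hc, hv⟩ := kill_gen (M := M) hn ha he hm (by omega) hjm hMm hk hmin ω
    have hM0 : (0:ℝ) < M := by exact_mod_cast (by omega : 0 < M)
    have key := use_bad D h0 h1 (M := M) (by omega) (by omega) hc ?_
    · by_cases hMm' : m ≤ ⌊(j:ℝ) ^ 2 / (128 * L)⌋₊
      · left
        rw [hM, min_eq_left hMm'] at key
        refine sqrt_bound hℓ1 hℓL hℓn ?_ key
        exact_mod_cast (by omega : n ≤ 120 * m)
      · right
        have hMe : M = ⌊(j:ℝ) ^ 2 / (128 * L)⌋₊ := min_eq_right (by omega)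
        have hMl : (j:ℝ) ^ 2 ≤ 256 * L * M := by
          have := Nat.lt_floor_add_one ((j:ℝ) ^ 2 / (128 * L))
          rw [← hMe, div_lt_iff₀ (by linarith)] at this
          have h1M : (1:ℝ) ≤ M := by exact_mod_cast (by omega : 1 ≤ M)
          nlinarith
        rcases key with h | h
        · have : (j:ℝ) ≤ M := by exact_mod_cast hMj
          linarith
        · have h3 : (j:ℝ) ^ 2 ≤ 256 * ((d:ℝ) + 1) ^ 2 := by linarith
          nlinarith
    · have ht := tail_upper (M := M) (by omega) ((j:ℝ) / 4) (by positivity)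
      have hsub : (Finset.univ.filter fun x : Fin M → Bool => op c s (wt x) ≠ ω ^ wt x) ⊆
          Finset.univ.filter fun x : Fin M → Bool => (j:ℝ) / 4 < |(wt x:ℝ) - M / 2| := by
        intro x hx
        simp only [Finset.mem_filter, Finset.mem_univ, true_and] at hx ⊢
        by_contra hcon
        apply hx
        have hab := abs_le.mp (not_lt.mp hcon)
        have n1 : 2 * M ≤ 4 * wt x + j := by
          have : (2:ℝ) * M ≤ 4 * wt x + j := by linarith [hab.1]
          exact_mod_cast this
        have n2 : 4 * wt x ≤ 2 * M + j := by
          have : (4:ℝ) * wt x ≤ 2 * M + j := by linarith [hab.2]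
          exact_mod_cast this
        have n3 : 100 < j := by
          have : (100:ℝ) < j := by linarith
          exact_mod_cast this
        exact hv _ (by omega) (by omega)
      refine (Nat.cast_le.mpr (Finset.card_le_card hsub)).trans (ht.trans ?_)
      have : 16 * L ≤ 2 * ((j:ℝ) / 4) ^ 2 / M := by
        rw [le_div_iff₀ hM0]
        nlinarith
      gcongr
end bounds


section cases
variable {K : Type} [Field K]

lemma bF_inj {x y : Bool} (h : bF K x = bF K y) : x = y := by
  cases x <;> cases y <;> simp_all [bF]

lemma bF_bool (x : Bool) : bF K x = 0 ∨ bF K x = 1 := by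
  cases x <;> simp [bF]

lemma core_main [IsAlgClosed K] {p : ℕ} [CharP K p] (hp : p = 0 ∨ p.Prime) {n d b : ℕ} {L ℓ : ℝ}
    {f : ℕ → Bool} (D : Data K n d L (fun i => bF K (f i)))
    (hℓ1 : 1 ≤ ℓ) (hℓL : ℓ ≤ L) (hℓn : ℓ ≤ n) (hn : 1000 ≤ n) (hb1 : 1 < b)
    (hb : ∀ i, (n + 2) / 3 ≤ i → i + b ≤ 2 * n / 3 → f i = f (i + b))
    (hmin : ∀ q, 1 ≤ q → (∀ i, (n + 2) / 3 ≤ i → i + q ≤ 2 * n / 3 → f i = f (i + q)) → b ≤ q) :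
    Real.sqrt (n * ℓ) ≤ 1000 * ((d:ℝ) + 1) ∨
      ((∃ t, b = p ^ t) ∧ (b:ℝ) ≤ 80 * ((d:ℝ) + 1)) := by
  classical
  set s : ℕ → K := fun i => bF K (f i) with hs
  obtain ⟨a, ha⟩ : ∃ a, a = (n + 2) / 3 := ⟨_, rfl⟩
  obtain ⟨e, he⟩ : ∃ e, e = 2 * n / 3 := ⟨_, rfl⟩
  obtain ⟨m, hm⟩ : ∃ m, m = n / 60 := ⟨_, rfl⟩
  rw [← ha, ← he] at hb hmin
  have hm1 : (n:ℝ) ≤ 120 * m := by exact_mod_cast (by omega : n ≤ 120 * m)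
  rcases dich (K := K) (n := n) (m := m) (a := a) (e := e) s (by omega) (by omega) (by omega) with
    ⟨ω, h0, h1, hg⟩ | ⟨j0, hj0, hk0⟩
  · left
    exact sqrt_bound hℓ1 hℓL hℓn hm1 (use_gen D h0 h1 (by omega) (by omega) hg)
  · have hex : ∃ j, Kill a e s j := ⟨j0, hk0⟩
    obtain ⟨j, hj⟩ : ∃ j, j = Nat.find hex := ⟨_, rfl⟩
    have hk : Kill a e s j := hj ▸ Nat.find_spec hex
    have hkm : ∀ j' < j, ¬ Kill a e s j' := fun j' h => Nat.find_min hex (hj ▸ h)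
    have hjm : j ≤ m := (hj ▸ Nat.find_min' hex hk0).trans hj0
    have hj2 : 2 ≤ j := by
      by_contra hlt
      have : b ≤ 1 := by
        refine hmin 1 le_rfl fun i h1 h2 => ?_
        apply bF_inj (K := K)
        change s i = s (i + 1)
        interval_cases j
        · have e1 := hk i h1 (by omega)
          have e2 := hk (i + 1) (by omega) (by omega)
          rw [pow_zero, ← pow_zero X, op_X_pow] at e1 e2
          rw [add_zero] at e1 e2
          rw [e1, e2]
        · have e1 := hk i h1 (by omega)
          have : ((X - 1 : K[X]) ^ 1) = X ^ 1 - X ^ 0 := by simp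
          rw [this, op_sub, op_X_pow, op_X_pow, add_zero] at e1
          exact (sub_eq_zero.mp e1).symm
      omega
    obtain ⟨hpp, τ, hτ, hper⟩ := period_char hp (fun i => bF_bool (f i)) hj2 hk hkm (by omega)
    have hq1 : 1 ≤ p ^ τ := Nat.one_le_pow _ _ hpp.pos
    have hperf : ∀ i, a ≤ i → i + p ^ τ ≤ e → f i = f (i + p ^ τ) :=
      fun i h1 h2 => bF_inj (K := K) (hper i h1 h2)
    have hdv := period_dvd (by omega) hb hmin (p ^ τ) hq1 hperf (by omega)
    obtain ⟨t, _, ht⟩ := (Nat.dvd_prime_pow hpp).mp hdv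
    rcases kill_bound D hℓ1 hℓL hℓn hn ha he hm hj2 hjm hk (hkm _ (by omega)) with h | h
    · left; exact h
    · right
      refine ⟨⟨t, ht⟩, ?_⟩
      have : (b:ℝ) ≤ 2 * j := by exact_mod_cast (hmin _ hq1 hperf).trans hτ
      linarith

lemma wt_eq_zero {M : ℕ} {x : Fin M → Bool} (h : wt x = 0) : x = fun _ => false := by
  unfold wt at h
  rw [Finset.card_eq_zero, Finset.filter_eq_empty_iff] at h
  funext i
  simpa using h (Finset.mem_univ i)

lemma wt_eq_top {M : ℕ} {x : Fin M → Bool} (h : wt x = M) : x = fun _ => true := by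
  unfold wt at h
  have h2 := (Finset.card_eq_iff_eq_univ _).mp (h.trans (Fintype.card_fin M).symm)
  funext i
  have : i ∈ Finset.univ.filter fun i => x i = true := by rw [h2]; simp
  simpa using this

lemma alt_single {M : ℕ} {t : ℕ → K} (y : Fin M → Bool)
    (hy : ∀ x : Fin M → Bool, wt x = wt y → x = y) (h0 : t (wt y) ≠ 0)
    (hz : ∀ k ≤ M, k ≠ wt y → t k = 0) :
    ∑ x : Fin M → Bool, (-1) ^ wt x * t (wt x) ≠ 0 := by
  rw [Finset.sum_eq_single y]
  · exact mul_ne_zero (pow_ne_zero _ (by simp)) h0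
  · intro x _ hx
    rw [hz _ (wt_le x) (fun h => hx (hy x h)), mul_zero]
  · simp

lemma use_all {n d : ℕ} {L : ℝ} {s : ℕ → K} (D : Data K n d L s) (hMn : d + 1 ≤ n) {c : K[X]}
    (hc : c.natDegree ≤ n - (d + 1))
    (hs : ∑ x : Fin (d + 1) → Bool, (-1) ^ wt x * op c s (wt x) ≠ 0) : L ≤ (d:ℝ) + 1 := by
  obtain ⟨δ, hC, hδ⟩ := D.comp
  have h := comp_all (comp_shift hMn hC c hc) (by omega) hs
  have h2 : (2:ℝ) ^ (d + 1) ≤ Real.exp ((d:ℝ) + 1) := by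
    have : (2:ℝ) ≤ Real.exp 1 := by linarith [Real.add_one_le_exp (1:ℝ)]
    calc (2:ℝ) ^ (d + 1) ≤ (Real.exp 1) ^ (d + 1) := by gcongr
      _ = Real.exp ((d:ℝ) + 1) := by rw [← Real.exp_nat_mul]; push_cast; ring_nf
  have h3 : (1:ℝ) ≤ Real.exp (-(16 * L)) * Real.exp ((d:ℝ) + 1) :=
    h.trans (mul_le_mul hδ h2 (by positivity) (by positivity))
  rw [← Real.exp_add, Real.one_le_exp_iff] at h3
  linarith [D.hL]

/-- `Left`/`right` form of the exceptional part of the spectrum -/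
lemma ends_main [IsAlgClosed K] {n d b B : ℕ} {L : ℝ} {s : ℕ → K} (D : Data K n d L s)
    (hn : 1000 ≤ n) (hb1 : 1 ≤ b) (hbn : 100 * b ≤ n) (hB1 : 1 ≤ B) (hB : B ≤ (n + 2) / 3)
    (hz : ∀ i, B ≤ i → i + B + b ≤ n → s (i + b) = s i)
    (hend : s (B - 1 + b) ≠ s (B - 1) ∨ s (n + 1 - B - b + b) ≠ s (n + 1 - B - b)) :
    ((n:ℝ) ≤ 100 * (d + 1) ∨ L ≤ (d:ℝ) + 1) ∧
    (B ≤ 2 ∨ (B:ℝ) ≤ 32 * (d + 1) ∨ L * B ≤ 4 * ((d:ℝ) + 1) ^ 2) := by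
  have hu : ∀ i, op (X ^ b - 1 : K[X]) s i = s (i + b) - s i := by
    intro i
    rw [← pow_zero X, op_sub, op_X_pow, op_X_pow, add_zero]
  have huz : ∀ i, B ≤ i → i + B + b ≤ n → op (X ^ b - 1 : K[X]) s i = 0 := by
    intro i h1 h2
    rw [hu, hz i h1 h2, sub_self]
  have hdeg : (X ^ b - 1 : K[X]).natDegree ≤ b := by
    refine (natDegree_sub_le _ _).trans ?_
    simp
  constructor
  · by_cases hdn : n ≤ 100 * (d + 1)
    · left; exact_mod_cast hdn
    · right
      rcases hend with h | h
      · refine use_all D (by omega) (c := X ^ (B - 1) * (X ^ b - 1)) ?_ ?_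
        · refine natDegree_mul_le.trans ?_
          rw [natDegree_X_pow]; omega
        · refine alt_single (fun _ => false) (fun x hx => ?_) ?_ ?_
          · exact wt_eq_zero (hx.trans (by simp [wt]))
          · rw [op_shift, hu]
            simp only [wt, Bool.false_eq_true, Finset.filter_false, Finset.card_empty, zero_add]
            exact sub_ne_zero.mpr h
          · intro k hk hk0
            simp only [wt, Bool.false_eq_true, Finset.filter_false, Finset.card_empty] at hk0
            rw [op_shift]
            exact huz _ (by omega) (by omega)
      · refine use_all D (by omega) (c := X ^ (n + 1 - B - b - (d + 1)) * (X ^ b - 1)) ?_ ?_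
        · refine natDegree_mul_le.trans ?_
          rw [natDegree_X_pow]; omega
        · have hw : wt (fun _ : Fin (d + 1) => true) = d + 1 := by simp [wt]
          refine alt_single (fun _ => true) (fun x hx => ?_) ?_ ?_
          · exact wt_eq_top (hx.trans hw)
          · rw [op_shift, hu, hw,
              show d + 1 + (n + 1 - B - b - (d + 1)) = n + 1 - B - b by omega]
            exact sub_ne_zero.mpr h
          · intro k hk hk0
            rw [hw] at hk0
            rw [op_shift]
            exact huz _ (by omega) (by omega)
  · by_cases hB2 : B ≤ 2
    · left; exact hB2
    · right
      obtain ⟨ω, h0, h1⟩ := exists_omega (K := K)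
      have hg : Gen n ((B - 1) / 2) s (fun k => ω ^ k) := by
        rcases hend with h | h
        · refine tri_gen hdeg (i0 := B - 1) (by omega) (by omega) ?_ (Or.inl ?_) _
          · rw [hu]; exact sub_ne_zero.mpr h
          · intro i h1 h2
            exact huz _ (by omega) (by omega)
        · refine tri_gen hdeg (i0 := n + 1 - B - b) (by omega) (by omega) ?_ (Or.inr ?_) _
          · rw [hu]; exact sub_ne_zero.mpr h
          · intro i h1 h2
            exact huz _ (by omega) (by omega)
      have hBM : (B:ℝ) ≤ 4 * ((B - 1) / 2 : ℕ) := by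
        exact_mod_cast (by omega : B ≤ 4 * ((B - 1) / 2))
      have hL := D.hL
      rcases use_gen D h0 h1 (by omega) (by omega) hg with h | h
      · left; linarith
      · right; nlinarith
end cases


lemma logb_facts {n : ℕ} (hn : 2 ≤ n) {ε : ℝ} (h1 : 1 / (2:ℝ) ^ n ≤ ε) (h3 : ε ≤ 1 / 3) :
    0 < ε ∧ 1 ≤ Real.logb 2 n ∧ 1 ≤ Real.logb 2 (1 / ε) ∧ Real.logb 2 (1 / ε) ≤ n := by
  have hε : 0 < ε := lt_of_lt_of_le (by positivity) h1
  have hn' : (2:ℝ) ≤ n := by exact_mod_cast hn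
  have h2 : (2:ℝ) ≤ 1 / ε := by
    rw [le_div_iff₀ hε]; linarith
  refine ⟨hε, ?_, ?_, ?_⟩
  · rw [Real.le_logb_iff_rpow_le (by norm_num) (by linarith)]; simpa using hn'
  · rw [Real.le_logb_iff_rpow_le (by norm_num) (by linarith)]; simpa using h2
  · rw [Real.logb_le_iff_le_rpow (by norm_num) (by linarith), Real.rpow_natCast]
    rw [div_le_iff₀ hε]
    rwa [div_le_iff₀' (by positivity)] at h1

lemma make_data {K : Type} [Field K] {n d : ℕ} (hn : 2 ≤ n) {ε : ℝ} (h1 : 1 / (2:ℝ) ^ n ≤ ε)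
    (h3 : ε ≤ 1 / 3) {s : ℕ → K} (hs : ∀ i, s i = 0 ∨ s i = 1) (h : Comp K n d ε s) :
    Data K n (64 * (40 * ⌈3 * Real.logb 2 n⌉₊) * d) (Real.logb 2 n + Real.logb 2 (1 / ε)) s := by
  obtain ⟨hε, hlam, hl1, hln⟩ := logb_facts hn h1 h3
  set lam := Real.logb 2 n with hlamdef
  set l := Real.logb 2 (1 / ε) with hldef
  set v := ⌈3 * lam⌉₊ with hv
  have hv3 : 3 * lam ≤ v := Nat.le_ceil _
  have hv1 : 1 ≤ v := by
    have : (1:ℝ) ≤ v := by linarith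
    exact_mod_cast this
  have hn' : (2:ℝ) ≤ n := by exact_mod_cast hn
  have hlog2 : (0.69:ℝ) < Real.log 2 := by linarith [Real.log_two_gt_d9]
  have hlog2' : Real.log 2 < 1 := by linarith [Real.log_two_lt_d9]
  have en : (n:ℝ) = Real.exp (lam * Real.log 2) := by
    rw [hlamdef, Real.logb, div_mul_cancel₀ _ (by linarith), Real.exp_log (by linarith)]
  have eε : 1 / ε = Real.exp (l * Real.log 2) := by
    rw [hldef, Real.logb, div_mul_cancel₀ _ (by linarith), Real.exp_log (by positivity)]
  have eε' : ε = Real.exp (-(l * Real.log 2)) := by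
    rw [Real.exp_neg, ← eε]; simp
  have hn1 : (n:ℝ) + 1 ≤ Real.exp ((lam + l) * Real.log 2) := by
    rw [add_mul, Real.exp_add, ← en, ← eε]
    have : (2:ℝ) ≤ 1 / ε := by
      rw [le_div_iff₀ hε]; linarith
    nlinarith
  refine ⟨⟨_, amplify' hs h hε h3 (40 * v) (by omega), ?_⟩, by linarith, ?_⟩
  · have : ε ^ (40 * v) = Real.exp (-((40 * v : ℕ) * (l * Real.log 2))) := by
      conv_lhs => rw [eε']
      rw [← Real.exp_nat_mul]; ring_nf
    rw [this]
    calc ((n:ℝ) + 1) * Real.exp (-((40 * v : ℕ) * (l * Real.log 2)))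
        ≤ Real.exp ((lam + l) * Real.log 2) * Real.exp (-((40 * v : ℕ) * (l * Real.log 2))) := by
          gcongr
      _ = Real.exp ((lam + l) * Real.log 2 - (40 * v : ℕ) * (l * Real.log 2)) := by
          rw [← Real.exp_add]; ring_nf
      _ ≤ _ := by
          rw [Real.exp_le_exp]
          push_cast
          have a1 : lam + l ≤ 2 * (lam * l) := by nlinarith
          have a2 : 3 * lam * l ≤ v * l := by nlinarith
          have a3 : 60 * (lam + l) ≤ 40 * v * l := by nlinarith
          nlinarith
  · refine hn1.trans ?_
    rw [Real.exp_le_exp]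
    nlinarith

lemma final_bound {n d0 : ℕ} {X lam l : ℝ} (hlam : 1 ≤ lam) (hd0 : 1 ≤ d0)
    (hl0 : 0 ≤ l) (hln : l ≤ n) (hX0 : 0 ≤ X) (hXn : X ≤ Real.sqrt (n * l))
    (h : 1000 ≤ n → X ≤ 100000 * ((64 * (40 * ⌈3 * lam⌉₊) * d0 : ℕ) + 1)) :
    (1 / 10 ^ 10 : ℝ) * X / lam ^ 1 ≤ d0 := by
  have hd : (1:ℝ) ≤ d0 := by exact_mod_cast hd0
  rw [pow_one, div_le_iff₀ (by linarith)]
  have h1 : 1 ≤ (d0:ℝ) * lam := by nlinarith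
  by_cases hn : 1000 ≤ n
  · have := h hn
    push_cast at this
    have hv : (⌈3 * lam⌉₊:ℝ) ≤ 4 * lam := by
      have := Nat.ceil_lt_add_one (a := 3 * lam) (by linarith)
      linarith
    have h2 : (⌈3 * lam⌉₊:ℝ) * d0 ≤ 4 * lam * d0 := by gcongr
    nlinarith
  · have hn' : (n:ℝ) ≤ 1000 := by exact_mod_cast (by omega : n ≤ 1000)
    have : Real.sqrt (n * l) ≤ 1000 := by
      rw [Real.sqrt_le_iff]
      refine ⟨by norm_num, ?_⟩
      nlinarith
    linarith

lemma nonconst {n : ℕ} (hn : 2 ≤ n) {f g : ℕ → Bool}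
    (hG : ∀ i, (n + 2) / 3 ≤ i → i ≤ 2 * n / 3 → g i = f i)
    (hmin : ∀ g' : ℕ → Bool, (∀ i, (n + 2) / 3 ≤ i → i ≤ 2 * n / 3 → g' i = f i) →
      period n g ≤ period n g')
    (h : 1 < period n g ∨ 1 ≤ Bparam n (fun i => Bool.xor (f i) (g i))) :
    ∃ i j, i ≤ n ∧ j ≤ n ∧ f i ≠ f j := by
  by_contra hcon
  push Not at hcon
  have hb : period n g ≤ 1 := period_le_core hmin le_rfl
    (fun i h1 h2 => hcon _ _ (by omega) (by omega))
  obtain ⟨p1, p2⟩ := period_spec n g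
  have hb1 : period n g = 1 := by omega
  rw [hb1] at p2
  have hg : ∀ i ≤ n, g i = g 0 := by
    intro i
    induction i with
    | zero => simp
    | succ i ih => intro hi; rw [← p2 i hi]; exact ih (by omega)
  have hfg : ∀ i ≤ n, f i = g i := by
    intro i hi
    rw [hg i hi, ← hg ((n + 2) / 3) (by omega), hG _ le_rfl (by omega)]
    exact hcon _ _ hi (by omega)
  rcases h with h | h
  · omega
  · have : Bparam n (fun i => Bool.xor (f i) (g i)) ≤ 0 := by
      refine Nat.sInf_le ?_
      intro i j _ hi _ hj
      simp [hfg i (by omega), hfg j (by omega)]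
    omega

/-- combination of all bounds -/
lemma combine {K : Type} [Field K] [IsAlgClosed K] {p : ℕ} [CharP K p] (hp : p = 0 ∨ p.Prime)
    {n d : ℕ} {L ℓ : ℝ} {f g : ℕ → Bool} (D : Data K n d L (fun i => bF K (f i)))
    (hℓ1 : 1 ≤ ℓ) (hℓL : ℓ ≤ L) (hℓn : ℓ ≤ n) (hn : 1000 ≤ n)
    (hG : ∀ i, (n + 2) / 3 ≤ i → i ≤ 2 * n / 3 → g i = f i)
    (hmin : ∀ g' : ℕ → Bool, (∀ i, (n + 2) / 3 ≤ i → i ≤ 2 * n / 3 → g' i = f i) →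
      period n g ≤ period n g') :
    (1 < period n g → Real.sqrt (n * ℓ) ≤ 1000 * ((d:ℝ) + 1) ∨
      ((∃ t, period n g = p ^ t) ∧ (period n g:ℝ) ≤ 80 * ((d:ℝ) + 1))) ∧
    (∀ B : ℕ, B = Bparam n (fun i => Bool.xor (f i) (g i)) → 1 ≤ B →
      min (Real.sqrt (n * ℓ)) ((period n g : ℝ) + Real.sqrt (B * ℓ) + ℓ) ≤
        100000 * ((d:ℝ) + 1)) := by
  obtain ⟨hb1, hb⟩ := period_spec n g
  have hA : 1 < period n g → Real.sqrt (n * ℓ) ≤ 1000 * ((d:ℝ) + 1) ∨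
      ((∃ t, period n g = p ^ t) ∧ (period n g:ℝ) ≤ 80 * ((d:ℝ) + 1)) := by
    intro h
    refine core_main hp D hℓ1 hℓL hℓn hn h (fun i h1 h2 => ?_)
      (fun q hq hqp => period_le_core hmin hq hqp)
    rw [← hG i h1 (by omega), ← hG (i + period n g) (by omega) h2]
    exact hb i (by omega)
  refine ⟨hA, ?_⟩
  intro B hBdef hB1
  have hd : (0:ℝ) ≤ d := Nat.cast_nonneg d
  obtain ⟨hB, hz, hend⟩ := Bparam_facts hn hG (hBdef ▸ hB1)
  rw [← hBdef] at hB hz hend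
  obtain ⟨b, hbdef⟩ : ∃ b, b = period n g := ⟨_, rfl⟩
  rw [← hbdef] at hA hb hb1 ⊢
  have hsq : ∀ C : ℝ, 0 ≤ C → (n:ℝ) ≤ C → Real.sqrt (n * ℓ) ≤ C := by
    intro C h0 hC
    rw [Real.sqrt_le_iff]
    exact ⟨h0, by nlinarith⟩
  by_cases hbn : 100 * b ≤ n
  · have hzs : ∀ i, B ≤ i → i + B + b ≤ n → bF K (f (i + b)) = bF K (f i) := by
      intro i h1 h2
      rw [hz i h1 (by omega), hz (i + b) (by omega) (by omega), hb i (by omega)]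
    have hends : bF K (f (B - 1 + b)) ≠ bF K (f (B - 1)) ∨
        bF K (f (n + 1 - B - b + b)) ≠ bF K (f (n + 1 - B - b)) := by
      rcases hend with h | h
      · left
        intro hh
        have := bF_inj hh
        rw [hz (B - 1 + b) (by omega) (by omega), ← hb _ (by omega)] at this
        exact h this.symm
      · right
        intro hh
        have := bF_inj hh
        rw [hz (n + 1 - B - b) (by omega) (by omega), hb _ (by omega),
          show n + 1 - B - b + b = n + 1 - B by omega] at this
        exact h this
    obtain ⟨h3, h4⟩ := ends_main D hn hb1 hbn hB1 hB hzs hends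
    rcases h3 with h3 | h3
    · refine (min_le_left _ _).trans (hsq _ (by positivity) (by linarith))
    have hl : ℓ ≤ (d:ℝ) + 1 := hℓL.trans h3
    have hBl : Real.sqrt (B * ℓ) ≤ 6 * ((d:ℝ) + 1) := by
      rw [Real.sqrt_le_iff]
      refine ⟨by positivity, ?_⟩
      have hB0 : (0:ℝ) ≤ B := Nat.cast_nonneg B
      rcases h4 with h4 | h4 | h4
      · have : (B:ℝ) ≤ 2 := by exact_mod_cast h4
        nlinarith
      · have := mul_le_mul h4 hl (by linarith) (by positivity)
        nlinarith
      · nlinarith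
    by_cases hb2 : 1 < b
    · rcases hA hb2 with h | ⟨_, h⟩
      · exact (min_le_left _ _).trans (by linarith)
      · exact (min_le_right _ _).trans (by linarith)
    · have : (b:ℝ) ≤ 1 := by exact_mod_cast (not_lt.mp hb2)
      exact (min_le_right _ _).trans (by linarith)
  · refine (min_le_left _ _).trans ?_
    rcases hA (by omega) with h | ⟨_, h⟩
    · linarith
    · have : (n:ℝ) ≤ 100 * b := by exact_mod_cast (by omega : n ≤ 100 * b)
      exact hsq _ (by positivity) (by linarith)


end aux

/-- the full lower bound on `pdeg_ε(f)` in terms of the standard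
decomposition `(g,h)`, up to a `(log n)^k` factor. -/
theorem stmt19 :
    ∃ c : ℝ, 0 < c ∧ ∃ k : ℕ,
      ∀ (F : Type) [Field F] (p : ℕ) [CharP F p], (p = 0 ∨ p.Prime) →
        ∀ n : ℕ, 2 ≤ n →
          ∀ (f : (Fin n → Bool) → Bool) (specF specG : ℕ → Bool),
            (∀ a, f a = specF (wt a)) →
            (∀ i, (n + 2) / 3 ≤ i → i ≤ 2 * n / 3 → specG i = specF i) →
            (∀ specG' : ℕ → Bool,
              (∀ i, (n + 2) / 3 ≤ i → i ≤ 2 * n / 3 → specG' i = specF i) →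
              period n specG ≤ period n specG') →
            ∀ ε : ℝ, 1 / (2:ℝ)^n ≤ ε → ε ≤ 1/3 →
              (1 < period n specG → ¬(∃ t : ℕ, period n specG = p ^ t) →
                c * Real.sqrt (n * Real.logb 2 (1/ε)) / (Real.logb 2 n)^k
                  ≤ (pdeg F f ε : ℝ)) ∧
              (1 < period n specG → (∃ t : ℕ, period n specG = p ^ t) →
                Bparam n (fun i => Bool.xor (specF i) (specG i)) = 0 →
                c * min (Real.sqrt (n * Real.logb 2 (1/ε))) (period n specG : ℝ)
                    / (Real.logb 2 n)^k
                  ≤ (pdeg F f ε : ℝ)) ∧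
              ((∃ t : ℕ, period n specG = p ^ t) →
                1 ≤ Bparam n (fun i => Bool.xor (specF i) (specG i)) →
                c * min (Real.sqrt (n * Real.logb 2 (1/ε)))
                      ((period n specG : ℝ) +
                        Real.sqrt
                          ((Bparam n (fun i => Bool.xor (specF i) (specG i)) : ℝ) *
                            Real.logb 2 (1/ε)) +
                        Real.logb 2 (1/ε))
                    / (Real.logb 2 n)^k
                  ≤ (pdeg F f ε : ℝ)) := by
  refine ⟨1 / 10 ^ 10, by positivity, 1, ?_⟩
  intro F _ p _ hp n hn f specF specG hf hG hmin ε hε1 hε3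
  obtain ⟨hε, hlam, hl1, hln⟩ := logb_facts hn hε1 hε3
  have hC := pdeg_comp F (AlgebraicClosure F) hf hε
  have hchar : CharP (AlgebraicClosure F) p :=
    charP_of_injective_algebraMap (algebraMap F (AlgebraicClosure F)).injective p
  have hpos : (1 < period n specG ∨ 1 ≤ Bparam n (fun i => Bool.xor (specF i) (specG i))) →
      1 ≤ pdeg F f ε := by
    intro h
    obtain ⟨i, j, hi, hj, hij⟩ := nonconst hn hG hmin h
    by_contra h0
    have h0 : pdeg F f ε = 0 := by omega
    rw [h0] at hC
    exact comp_zero_false hC hε3 hi hj (fun h => hij (bF_inj h))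
  have D := make_data hn hε1 hε3 (fun i => bF_bool (specF i)) hC
  have main := fun hn' : 1000 ≤ n => combine hp D hl1 (by linarith) hln hn' hG hmin
  have hl0 : 0 ≤ Real.logb 2 (1 / ε) := by linarith
  have hcast : (0:ℝ) ≤ ((64 * (40 * ⌈3 * Real.logb 2 n⌉₊) * pdeg F f ε : ℕ) : ℝ) :=
    Nat.cast_nonneg _
  refine ⟨fun hb hnp => ?_, fun hb _ _ => ?_, fun _ hB => ?_⟩
  · refine final_bound hlam (hpos (Or.inl hb)) hl0 hln (Real.sqrt_nonneg _) le_rfl fun hn' => ?_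
    rcases (main hn').1 hb with h | ⟨h, _⟩
    · linarith
    · exact absurd h hnp
  · refine final_bound hlam (hpos (Or.inl hb)) hl0 hln (by positivity) (min_le_left _ _)
      fun hn' => ?_
    rcases (main hn').1 hb with h | ⟨_, h⟩
    · exact (min_le_left _ _).trans (by linarith)
    · exact (min_le_right _ _).trans (by linarith)
  · refine final_bound hlam (hpos (Or.inr hB)) hl0 hln (by positivity) (min_le_left _ _)
      fun hn' => (main hn').2 _ rfl hB
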